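/- arXiv:1202.6129 — 3 statements merged into one kernel-verified Lean document; each statement's English description precedes it below -/
import Mathlib

section
/- Let G be an acyclically edge (Δ(G)+2)-critical finite simple graph, and let v be a vertex of degree t with t ≥ 5. If v has exactly t − 4 neighbors of degree 2, then v has no neighbor of degree 3. -/
open SimpleGraph

/-- A proper edge coloring of `G`: distinct edges sharing a vertex get distinct colors. -/
def IsProperEdgeColoring {V : Type*} {α : Type*} (G : SimpleGraph V) (c : Sym2 V → α) : Prop :=
  ∀ e₁ ∈ G.edgeSet, ∀ e₂ ∈ G.edgeSet, e₁ ≠ e₂ → (∃ v, v ∈ e₁ ∧ v ∈ e₂) → c e₁ ≠ c e₂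

/-- An acyclic edge coloring: proper, and no cycle of `G` uses at most two colors. -/
def IsAcyclicEdgeColoring {V : Type*} {α : Type*} (G : SimpleGraph V) (c : Sym2 V → α) : Prop :=
  IsProperEdgeColoring G c ∧
    ∀ (v : V) (w : G.Walk v v), w.IsCycle →
      ¬ ∃ a b : α, ∀ e ∈ w.edges, c e = a ∨ c e = b

/-- `G` has an acyclic edge coloring with `k` colors. -/
def AcyclicEdgeColorable {V : Type*} (G : SimpleGraph V) (k : ℕ) : Prop :=
  ∃ c : Sym2 V → Fin k, IsAcyclicEdgeColoring G c

/-- The acyclic chromatic index: least `k` such that `G` is acyclically edge `k`-colorable. -/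
noncomputable def acyclicChromaticIndex {V : Type*} (G : SimpleGraph V) : ℕ :=
  sInf {k | AcyclicEdgeColorable G k}

/-- `G` is acyclically edge `k`-critical: `G` is not acyclically edge `k`-colorable, but every
proper subgraph of `G` is. -/
def IsAcyclicallyEdgeCritical {V : Type*} (G : SimpleGraph V) (k : ℕ) : Prop :=
  ¬ AcyclicEdgeColorable G k ∧ ∀ H : SimpleGraph V, H < G → AcyclicEdgeColorable H k

namespace SimpleGraph

section General

variable {V : Type*} {B B' : SimpleGraph V}

/-- A vertex with at most one neighbor. -/
def IsEnd (B : SimpleGraph V) (x : V) : Prop :=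
  ∀ y z, B.Adj x y → B.Adj x z → y = z

/-- Every vertex has at most two neighbors. -/
def AtMostTwoNeighbors (B : SimpleGraph V) : Prop :=
  ∀ x y z s, B.Adj x y → B.Adj x z → B.Adj x s → y = z ∨ y = s ∨ z = s

theorem IsEnd.anti (h : B' ≤ B) {x : V} (hx : B.IsEnd x) : B'.IsEnd x :=
  fun y z hy hz => hx y z (h hy) (h hz)

theorem AtMostTwoNeighbors.anti (h : B' ≤ B) (hB : B.AtMostTwoNeighbors) :
    B'.AtMostTwoNeighbors :=
  fun x y z s hy hz hs => hB x y z s (h hy) (h hz) (h hs)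

theorem Reachable.mem_of_closed {X : Set V} (hX : ∀ x ∈ X, ∀ y, B.Adj x y → y ∈ X) {x y : V}
    (h : B.Reachable x y) (hx : x ∈ X) : y ∈ X := by
  obtain ⟨p⟩ := h
  induction p with
  | nil => exact hx
  | cons h _ ih => exact ih (hX _ hx _ h)

theorem AtMostTwoNeighbors.isPath_end_unique (hB : B.AtMostTwoNeighbors) {x q : V}
    (P : B.Walk x q) (hP : P.IsPath) (hq : B.IsEnd q) {r : V} (hr : B.IsEnd r) (o : V)
    (ho : B.Adj x o) (hoP : o ∉ P.support) (Q : B.Walk x r) (hQ : Q.IsPath)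
    (hoQ : o ∉ Q.support) : q = r := by
  induction P generalizing o with
  | nil =>
    cases Q with
    | nil => rfl
    | cons h Q' =>
      have := hq _ _ ho h
      subst this
      simp at hoQ
  | @cons x y q h P' ih =>
    cases Q with
    | nil =>
      have := hr _ _ ho h
      subst this
      simp at hoP
    | @cons _ z _ h' Q' =>
      rw [Walk.cons_isPath_iff] at hP hQ
      have hyo : o ≠ y := by rintro rfl; simp at hoP
      have hzo : o ≠ z := by rintro rfl; simp at hoQ
      obtain rfl : y = z := by
        have := hB _ _ _ _ ho h h'
        tauto
      exact ih hP.1 hq _ h.symm hP.2 _ hQ.1 hQ.2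

theorem AtMostTwoNeighbors.end_unique (hB : B.AtMostTwoNeighbors) {p q r : V}
    (hp : B.IsEnd p) (hq : B.IsEnd q) (hr : B.IsEnd r) (hpq : p ≠ q) (hpr : p ≠ r)
    (h1 : B.Reachable p q) (h2 : B.Reachable p r) : q = r := by
  obtain ⟨P, hP⟩ := h1.exists_isPath
  obtain ⟨Q, hQ⟩ := h2.exists_isPath
  cases P with
  | nil => exact absurd rfl hpq
  | cons h P' =>
    cases Q with
    | nil => exact absurd rfl hpr
    | cons h' Q' =>
      obtain rfl := hp _ _ h h'
      rw [Walk.cons_isPath_iff] at hP hQ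
      exact hB.isPath_end_unique P' hP.1 hq hr _ h.symm hP.2 Q' hQ.1 hQ.2

theorem Reachable.avoid_ends {R : Set V} (hR : ∀ r ∈ R, B.IsEnd r)
    (hB : ∀ x y, B.Adj x y → x ∉ R → y ∉ R → B'.Adj x y) {x y : V} (h : B.Reachable x y)
    (hx : x ∉ R) (hy : y ∉ R) : B'.Reachable x y := by
  obtain ⟨P, hP⟩ := h.exists_isPath
  clear h
  induction P with
  | nil => exact Reachable.refl _
  | @cons x z y h P' ih =>
    rw [Walk.cons_isPath_iff] at hP
    by_cases hz : z ∈ R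
    · cases P' with
      | nil => exact absurd hz hy
      | cons h' P'' =>
        obtain rfl := hR _ hz _ _ h.symm h'
        simp at hP
    · exact (hB _ _ h hx hz).reachable.trans (ih hz hy hP.1)

end General

section Coloring

variable {V α : Type*} {H H₀ : SimpleGraph V} {c : Sym2 V → α}

/-- The subgraph formed by the edges of the two given colors. -/
def bicolored (H : SimpleGraph V) (c : Sym2 V → α) (a b : α) : SimpleGraph V where
  Adj x y := H.Adj x y ∧ (c s(x, y) = a ∨ c s(x, y) = b)
  symm := ⟨fun x y h => ⟨h.1.symm, by rw [Sym2.eq_swap]; exact h.2⟩⟩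
  loopless := ⟨fun x h => H.loopless.irrefl x h.1⟩

theorem bicolored_adj {a b : α} {x y : V} :
    (bicolored H c a b).Adj x y ↔ H.Adj x y ∧ (c s(x, y) = a ∨ c s(x, y) = b) := Iff.rfl

theorem bicolored_comm (a b : α) : bicolored H c a b = bicolored H c b a := by
  ext x y
  simp only [bicolored_adj, or_comm]

theorem bicolored_mono (h : H₀ ≤ H) (a b : α) : bicolored H₀ c a b ≤ bicolored H c a b :=
  fun _ _ hxy => ⟨h hxy.1, hxy.2⟩

/-- The color `a` does not appear on an edge at `x`. -/
def Missing (H : SimpleGraph V) (c : Sym2 V → α) (x : V) (a : α) : Prop :=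
  ∀ y, H.Adj x y → c s(x, y) ≠ a

theorem Missing.anti (h : H₀ ≤ H) {x : V} {a : α} (hx : Missing H c x a) : Missing H₀ c x a :=
  fun y hy => hx y (h hy)

/-- An acyclic edge coloring, stated through vertices and two-colored subgraphs. -/
structure IsAcyclicColoring (H : SimpleGraph V) (c : Sym2 V → α) : Prop where
  proper : ∀ ⦃x y z⦄, H.Adj x y → H.Adj x z → c s(x, y) = c s(x, z) → y = z
  acyclic : ∀ a b, (bicolored H c a b).IsAcyclic

theorem isAcyclicEdgeColoring_iff :
    IsAcyclicEdgeColoring H c ↔ IsAcyclicColoring H c := by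
  constructor
  · rintro ⟨hp, hc⟩
    refine ⟨fun x y z hy hz h => ?_, fun a b v w hw => ?_⟩
    · by_contra hne
      refine hp s(x, y) hy s(x, z) hz ?_ ⟨x, by simp, by simp⟩ h
      exact fun he => hne (Sym2.congr_right.1 he)
    · have hle : bicolored H c a b ≤ H := fun _ _ h => h.1
      refine hc v (w.mapLe hle) ((Walk.isCycle_mapLe hle).2 hw) ⟨a, b, fun e he => ?_⟩
      rw [Walk.edges_mapLe_eq_edges] at he
      have := w.edges_subset_edgeSet he
      induction e with
      | _ x y => exact this.2
  · rintro ⟨hp, hc⟩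
    refine ⟨fun e₁ h₁ e₂ h₂ hne hv h => ?_, fun v w hw ⟨a, b, hab⟩ => ?_⟩
    · obtain ⟨v, hv₁, hv₂⟩ := hv
      obtain ⟨y, rfl⟩ := Sym2.mem_iff_exists.1 hv₁
      obtain ⟨z, rfl⟩ := Sym2.mem_iff_exists.1 hv₂
      exact hne (Sym2.congr_right.2 (hp h₁ h₂ h))
    · have hw' : ∀ e ∈ w.edges, e ∈ (bicolored H c a b).edgeSet := by
        intro e he
        have h1 := hab e he
        have h2 := w.edges_subset_edgeSet he
        induction e with
        | _ x y => exact ⟨h2, h1⟩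
      exact hc a b _ (hw.transfer hw')

theorem IsAcyclicColoring.anti (h : H₀ ≤ H) (hc : IsAcyclicColoring H c) :
    IsAcyclicColoring H₀ c :=
  ⟨fun _ _ _ hy hz => hc.proper (h hy) (h hz),
    fun a b => (hc.acyclic a b).anti (bicolored_mono h a b)⟩

theorem IsAcyclicColoring.atMostTwoNeighbors (hc : IsAcyclicColoring H c) (a b : α) :
    (bicolored H c a b).AtMostTwoNeighbors := by
  rintro x y z s ⟨hy, cy⟩ ⟨hz, cz⟩ ⟨hs, cs⟩
  have h1 := hc.proper hy hz
  have h2 := hc.proper hy hs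
  have h3 := hc.proper hz hs
  grind

theorem IsAcyclicColoring.isEnd_left (hc : IsAcyclicColoring H c) {a b : α} {x : V}
    (h : Missing H c x a) : (bicolored H c a b).IsEnd x := by
  rintro y z ⟨hy, cy⟩ ⟨hz, cz⟩
  have h1 := h y hy
  have h2 := h z hz
  exact hc.proper hy hz (by grind)

theorem IsAcyclicColoring.isEnd_right (hc : IsAcyclicColoring H c) {a b : α} {x : V}
    (h : Missing H c x b) : (bicolored H c a b).IsEnd x := by
  rw [bicolored_comm]
  exact hc.isEnd_left h

theorem eq_of_reachable_of_missing {a b : α} {x y : V} (ha : Missing H c x a)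
    (hb : Missing H c x b) (h : (bicolored H c a b).Reachable x y) : y = x := by
  refine h.mem_of_closed (X := {x}) ?_ rfl
  rintro _ rfl z ⟨hz, h | h⟩
  exacts [absurd h (ha z hz), absurd h (hb z hz)]

variable [DecidableEq V]

theorem IsAcyclicColoring.add_edge (hc : IsAcyclicColoring H₀ c) {x y : V} {θ : α}
    (hH : ∀ p q, H.Adj p q → H₀.Adj p q ∨ s(p, q) = s(x, y)) (hn : ¬H₀.Adj x y)
    (hx : Missing H₀ c x θ) (hy : Missing H₀ c y θ)
    (hr : ∀ m, m ≠ θ → ¬(bicolored H₀ c m θ).Reachable x y) (hxy : x ≠ y) :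
    IsAcyclicColoring H (Function.update c s(x, y) θ) := by
  have hne : ∀ p q, H₀.Adj p q → s(p, q) ≠ s(x, y) := by
    intro p q h he
    rcases Sym2.eq_iff.1 he with ⟨rfl, rfl⟩ | ⟨rfl, rfl⟩
    exacts [hn h, hn h.symm]
  have hold : ∀ p q, H₀.Adj p q → Function.update c s(x, y) θ s(p, q) = c s(p, q) :=
    fun p q h => Function.update_of_ne (hne p q h) _ _
  have hle : ∀ m, (bicolored H (Function.update c s(x, y) θ) m θ).IsAcyclic := by
    intro m
    have hr' : ¬(bicolored H₀ c m θ).Reachable x y := by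
      by_cases hm : m = θ
      · subst hm
        exact fun h => hxy (eq_of_reachable_of_missing hx hx h).symm
      · exact hr m hm
    refine ((hc.acyclic m θ).sup_edge_of_not_reachable hr').anti ?_
    rintro p q ⟨h, h'⟩
    rw [sup_adj]
    rcases hH p q h with h0 | h0
    · rw [hold p q h0] at h'
      exact Or.inl ⟨h0, h'⟩
    · right
      rw [edge_adj]
      refine ⟨?_, h.ne⟩
      simpa using h0
  refine ⟨fun p q r hq hr' h => ?_, fun a b => ?_⟩
  · have key : ∀ {p q r}, H₀.Adj p q → s(p, r) = s(x, y) → c s(p, q) ≠ θ := by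
      intro p q r h1 h2
      rcases Sym2.eq_iff.1 h2 with ⟨rfl, rfl⟩ | ⟨rfl, rfl⟩
      exacts [hx q h1, hy q h1]
    rcases hH p q hq with h1 | h1 <;> rcases hH p r hr' with h2 | h2
    · rw [hold _ _ h1, hold _ _ h2] at h
      exact hc.proper h1 h2 h
    · rw [hold _ _ h1, h2, Function.update_self] at h
      exact absurd h (key h1 h2)
    · rw [hold _ _ h2, h1, Function.update_self] at h
      exact absurd h.symm (key h2 h1)
    · exact Sym2.congr_right.1 (h1.trans h2.symm)
  · by_cases ha : a = θ
    · subst ha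
      rw [bicolored_comm]
      exact hle b
    by_cases hb : b = θ
    · subst hb
      exact hle a
    refine (hc.acyclic a b).anti ?_
    rintro p q ⟨h, h'⟩
    rcases hH p q h with h0 | h0
    · rw [hold p q h0] at h'
      exact ⟨h0, h'⟩
    · rw [h0, Function.update_self] at h'
      rcases h' with rfl | rfl
      exacts [absurd rfl ha, absurd rfl hb]

/-- Adding a path of length two through a vertex without edges. -/
theorem IsAcyclicColoring.add_path (hc : IsAcyclicColoring H₀ c) {v l l' : V} {m θ : α}
    (hl : ∀ y, ¬H₀.Adj l y) (hvl : v ≠ l) (hl' : l ≠ l') (hv' : l' ≠ v)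
    (hH : ∀ p q, H.Adj p q → H₀.Adj p q ∨ s(p, q) = s(l, l') ∨ s(p, q) = s(v, l))
    (hm : Missing H₀ c l' m) (hθ : Missing H₀ c v θ) (hmθ : m ≠ θ)
    (hr : ¬(bicolored H₀ c m θ).Reachable v l') :
    IsAcyclicColoring H (Function.update (Function.update c s(l, l') m) s(v, l) θ) := by
  let H₁ : SimpleGraph V := H₀ ⊔ edge l l'
  have hl_miss : ∀ a, Missing H₀ c l a := fun a y hy => absurd hy (hl y)
  have hH₁ : ∀ p q, H₁.Adj p q → H₀.Adj p q ∨ s(p, q) = s(l, l') := by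
    intro p q h
    rcases h with h | h
    · exact Or.inl h
    · rw [edge_adj] at h
      right
      simpa using h.1
  have hold : ∀ p q, H₀.Adj p q → Function.update c s(l, l') m s(p, q) = c s(p, q) := by
    intro p q h
    refine Function.update_of_ne ?_ _ _
    intro he
    rcases Sym2.eq_iff.1 he with ⟨rfl, rfl⟩ | ⟨rfl, rfl⟩
    exacts [hl _ h, hl _ h.symm]
  have hc₁ : IsAcyclicColoring H₁ (Function.update c s(l, l') m) :=
    hc.add_edge hH₁ (hl l') (hl_miss m) hm
      (fun a _ h => hl' (eq_of_reachable_of_missing (hl_miss a) (hl_miss m) h).symm) hl'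
  have hll' : ∀ y, H₁.Adj l y → y = l' := by
    intro y hy
    rcases hH₁ _ _ hy with h | h
    · exact absurd h (hl y)
    · exact Sym2.congr_right.1 h
  refine hc₁.add_edge ?_ ?_ ?_ ?_ ?_ hvl
  · intro p q h
    rcases hH p q h with h | h | h
    · exact Or.inl (Or.inl h)
    · left; right
      rw [edge_adj]
      refine ⟨by simpa using h, ?_⟩
      rcases Sym2.eq_iff.1 h with ⟨rfl, rfl⟩ | ⟨rfl, rfl⟩
      exacts [hl', hl'.symm]
    · exact Or.inr h
  · exact fun h => hv' (hll' v h.symm).symm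
  · intro y hy
    rcases hH₁ _ _ hy with h | h
    · rw [hold _ _ h]
      exact hθ y h
    · rcases Sym2.eq_iff.1 h with ⟨rfl, rfl⟩ | ⟨rfl, rfl⟩
      exacts [absurd rfl hvl, absurd rfl hv']
  · intro y hy
    rw [hll' y hy, Function.update_self]
    exact hmθ
  · intro a ha h
    by_cases ham : a = m
    · subst ham
      have h' := h.symm
      have hadj : (bicolored H₁ (Function.update c s(l, l') a) a θ).Adj l l' := by
        refine ⟨Or.inr ?_, Or.inl (Function.update_self _ _ _)⟩
        rw [edge_adj]
        exact ⟨by simp, hl'⟩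
      refine hr (Reachable.symm ?_)
      refine (hadj.symm.reachable.trans h').avoid_ends (R := {l}) ?_ ?_ ?_ ?_
      · rintro _ rfl y z hy hz
        rw [hll' _ hy.1, hll' _ hz.1]
      · rintro x y ⟨hxy, hcol⟩ hx hy
        rcases hH₁ _ _ hxy with h0 | h0
        · rw [hold _ _ h0] at hcol
          exact ⟨h0, hcol⟩
        · rcases Sym2.eq_iff.1 h0 with ⟨rfl, rfl⟩ | ⟨rfl, rfl⟩
          exacts [absurd rfl hx, absurd rfl hy]
      · exact fun h => hl' h.symm
      · exact hvl
    · refine hvl (eq_of_reachable_of_missing (H := H₁)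
        (c := Function.update c s(l, l') m) (a := a) (b := θ) ?_ ?_ h.symm)
      · intro y hy
        rw [hll' y hy, Function.update_self]
        exact fun h => ham h.symm
      · intro y hy
        rw [hll' y hy, Function.update_self]
        exact hmθ

end Coloring

section Configuration

variable {V : Type*} {k : ℕ}

/-- The configuration left after removing a degree-two neighbor of `v`, whose other neighbor
is `u'`, from a critical graph. The neighbors of `v` outside `S` have small degree, and `w` is
the only one of them that may have degree three. -/
structure IsCriticalConfig (H : SimpleGraph V) (k : ℕ) (v u' w : V) (S : Set V) : Prop where
  reachable : ∀ c : Sym2 V → Fin k, IsAcyclicColoring H c → ∀ a θ, Missing H c u' a →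
    Missing H c v θ → a ≠ θ → (bicolored H c a θ).Reachable v u'
  ne : u' ≠ v
  ncard_v : (H.neighborSet v).ncard + 3 ≤ k
  ncard_u' : (H.neighborSet u').ncard + 3 ≤ k
  ncard_le : ∀ x, (H.neighborSet x).ncard + 2 ≤ k
  adj_S : ∀ s ∈ S, H.Adj v s
  ncard_S : S.ncard ≤ 3
  adj_w : H.Adj v w
  w_notMem : w ∉ S
  ncard_w : (H.neighborSet w).ncard ≤ 3
  ncard_low : ∀ r, H.Adj v r → r ∉ S → r ≠ w → (H.neighborSet r).ncard ≤ 2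

/-- The set of colors not used at `x`. -/
def freeColors (H : SimpleGraph V) (c : Sym2 V → Fin k) (x : V) : Set (Fin k) :=
  {a | Missing H c x a}

theorem mem_freeColors {H : SimpleGraph V} {c : Sym2 V → Fin k} {x : V} {a : Fin k} :
    a ∈ freeColors H c x ↔ Missing H c x a := Iff.rfl

theorem not_missing_iff {α : Type*} {H : SimpleGraph V} {c : Sym2 V → α} {x : V} {a : α} :
    ¬Missing H c x a ↔ ∃ y, H.Adj x y ∧ c s(x, y) = a := by
  simp [Missing]

theorem freeColors_eq (H : SimpleGraph V) (c : Sym2 V → Fin k) (x : V) :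
    freeColors H c x = ((fun y => c s(x, y)) '' H.neighborSet x)ᶜ := by
  ext a
  simp [mem_freeColors, Missing]

theorem ncard_compl_freeColors_le [Finite V] (H : SimpleGraph V) (c : Sym2 V → Fin k) (x : V) :
    ((freeColors H c x)ᶜ).ncard ≤ (H.neighborSet x).ncard := by
  rw [freeColors_eq, compl_compl]
  exact Set.ncard_image_le

theorem le_ncard_freeColors [Finite V] (H : SimpleGraph V) (c : Sym2 V → Fin k) (x : V) :
    k ≤ (freeColors H c x).ncard + (H.neighborSet x).ncard := by
  have h1 := ncard_compl_freeColors_le H c x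
  have h2 := Set.ncard_add_ncard_compl (freeColors H c x)
  rw [Nat.card_eq_fintype_card, Fintype.card_fin] at h2
  omega

/-- The neighbors of `v` other than `w` that are not in `S`. -/
def lowVerts (H : SimpleGraph V) (v w : V) (S : Set V) : Set V :=
  {r | H.Adj v r ∧ r ∉ S ∧ r ≠ w}

/-- The graph `H` without the edges at `v` and at its neighbors in `lowVerts`. -/
def core (H : SimpleGraph V) (v w : V) (S : Set V) : SimpleGraph V where
  Adj p q := H.Adj p q ∧ p ∉ insert v (lowVerts H v w S) ∧ q ∉ insert v (lowVerts H v w S)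
  symm := ⟨fun _ _ h => ⟨h.1.symm, h.2.2, h.2.1⟩⟩
  loopless := ⟨fun x h => H.loopless.irrefl x h.1⟩

theorem core_le {H : SimpleGraph V} {v w : V} {S : Set V} : core H v w S ≤ H := fun _ _ h => h.1

namespace IsCriticalConfig

variable {H : SimpleGraph V} {v u' w : V} {S : Set V} {c : Sym2 V → Fin k}

theorem ncard_low' (h : IsCriticalConfig H k v u' w S) {r : V} (hr : H.Adj v r) (hS : r ∉ S) :
    (H.neighborSet r).ncard ≤ 3 := by
  by_cases hw : r = w
  · exact hw ▸ h.ncard_w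
  · exact (h.ncard_low r hr hS hw).trans (by norm_num)

theorem not_missing_of_missing (h : IsCriticalConfig H k v u' w S) (hc : IsAcyclicColoring H c)
    {s : V} (hs : H.Adj v s) (hu : Missing H c u' (c s(v, s))) {θ : Fin k}
    (hθ : Missing H c v θ) : ¬Missing H c s θ := by
  intro hsθ
  have hr := h.reachable c hc _ θ hu hθ (hθ s hs)
  have hmem : u' ∈ ({v, s} : Set V) := by
    refine hr.mem_of_closed ?_ (by simp)
    rintro x (rfl | rfl) y ⟨hy, hcol⟩
    · rcases hcol with hcol | hcol
      · right
        exact hc.proper hy hs hcol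
      · exact absurd hcol (hθ y hy)
    · rcases hcol with hcol | hcol
      · left
        rw [Sym2.eq_swap (a := v)] at hcol
        exact hc.proper hy hs.symm hcol
      · exact absurd hcol (hsθ y hy)
  rcases hmem with rfl | rfl
  · exact h.ne rfl
  · exact hu v hs.symm (by rw [Sym2.eq_swap])

variable [Finite V]

theorem three_le_free_v (h : IsCriticalConfig H k v u' w S) (c : Sym2 V → Fin k) :
    3 ≤ (freeColors H c v).ncard := by
  have := le_ncard_freeColors H c v
  have := h.ncard_v
  omega

theorem three_le_free_u' (h : IsCriticalConfig H k v u' w S) (c : Sym2 V → Fin k) :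
    3 ≤ (freeColors H c u').ncard := by
  have := le_ncard_freeColors H c u'
  have := h.ncard_u'
  omega

theorem exists_mem_of_missing (h : IsCriticalConfig H k v u' w S) (hc : IsAcyclicColoring H c)
    {a : Fin k} (ha : Missing H c u' a) : ∃ s ∈ S, c s(v, s) = a := by
  have hav : ¬Missing H c v a := by
    intro hav
    obtain ⟨θ, hθ, hne⟩ := Set.exists_ne_of_one_lt_ncard
      (lt_of_lt_of_le (by norm_num) (h.three_le_free_v c)) a
    exact h.ne (eq_of_reachable_of_missing hav hθ (h.reachable c hc a θ ha hθ hne.symm))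
  obtain ⟨s, hs, rfl⟩ := not_missing_iff.1 hav
  refine ⟨s, ?_, rfl⟩
  by_contra hS
  have h1 := h.ncard_low' hs hS
  have h2 := ncard_compl_freeColors_le H c s
  have h3 : insert (c s(v, s)) (freeColors H c v) ⊆ (freeColors H c s)ᶜ := by
    rintro θ (rfl | hθ)
    · exact fun hm => hm v hs.symm (by rw [Sym2.eq_swap])
    · exact h.not_missing_of_missing hc hs ha hθ
  have h4 := Set.ncard_le_ncard h3
  rw [Set.ncard_insert_of_notMem (fun hm : Missing H c v _ => hm s hs rfl)] at h4
  have := h.three_le_free_v c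
  omega

theorem free_u'_eq (h : IsCriticalConfig H k v u' w S) (hc : IsAcyclicColoring H c) :
    freeColors H c u' = (fun s => c s(v, s)) '' S := by
  refine Set.eq_of_subset_of_ncard_le (fun a ha => ?_) ?_
  · obtain ⟨s, hs, rfl⟩ := h.exists_mem_of_missing hc ha
    exact ⟨s, hs, rfl⟩
  · exact (Set.ncard_image_le (Set.toFinite S)).trans (h.ncard_S.trans (h.three_le_free_u' c))

theorem ncard_free_u' (h : IsCriticalConfig H k v u' w S) (hc : IsAcyclicColoring H c) :
    (freeColors H c u').ncard = 3 := by
  refine le_antisymm ?_ (h.three_le_free_u' c)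
  rw [h.free_u'_eq hc]
  exact (Set.ncard_image_le (Set.toFinite S)).trans h.ncard_S

theorem ncard_S_eq (h : IsCriticalConfig H k v u' w S) (hc : IsAcyclicColoring H c) :
    S.ncard = 3 := by
  refine le_antisymm h.ncard_S ?_
  rw [← h.ncard_free_u' hc, h.free_u'_eq hc]
  exact Set.ncard_image_le

theorem missing_u' (h : IsCriticalConfig H k v u' w S) (hc : IsAcyclicColoring H c) {s : V}
    (hs : s ∈ S) : Missing H c u' (c s(v, s)) := by
  rw [← mem_freeColors, h.free_u'_eq hc]
  exact ⟨s, hs, rfl⟩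

theorem ne_of_mem (h : IsCriticalConfig H k v u' w S) (hc : IsAcyclicColoring H c) {s : V}
    (hs : s ∈ S) : u' ≠ s := by
  rintro rfl
  exact h.missing_u' hc hs v (h.adj_S _ hs).symm (by rw [Sym2.eq_swap])

/-- The path from `v` towards `r` through a two-colored subgraph with colors `m` and `θ` is
blocked right after the first vertex, unless it starts at a vertex of `S`. -/
def Safe (H : SimpleGraph V) (c : Sym2 V → Fin k) (v : V) (S : Set V) (m θ : Fin k) : Prop :=
  m ≠ θ ∧ ∀ r, H.Adj v r → r ∉ S → c s(v, r) = m → ∀ n, n ≠ v → H.Adj r n → c s(r, n) ≠ θ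

theorem not_reachable_of_safe (h : IsCriticalConfig H k v u' w S) (hc : IsAcyclicColoring H c)
    {m θ : Fin k} (hθ : Missing H c v θ) (hs : Safe H c v S m θ) {n : V} (hn : n ≠ v)
    (hnm : Missing H c n m ∨ Missing H c n θ) (hu : Missing H c u' m → n ≠ u')
    (hvn : H.Adj v n → c s(v, n) ≠ m) : ¬(bicolored H c m θ).Reachable v n := by
  intro hr
  by_cases hm : Missing H c v m
  · exact hn (eq_of_reachable_of_missing hm hθ hr)
  obtain ⟨r, hvr, hrm⟩ := not_missing_iff.1 hm
  by_cases hrS : r ∈ S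
  · have hum : Missing H c u' m := hrm ▸ h.missing_u' hc hrS
    have hr' := h.reachable c hc m θ hum hθ hs.1
    refine hu hum ((hc.atMostTwoNeighbors m θ).end_unique (hc.isEnd_right hθ) ?_
      (hc.isEnd_left hum) hn.symm h.ne.symm hr hr')
    rcases hnm with hnm | hnm
    exacts [hc.isEnd_left hnm, hc.isEnd_right hnm]
  · have hmem : n ∈ ({v, r} : Set V) := by
      refine hr.mem_of_closed ?_ (by simp)
      rintro x (rfl | rfl) y ⟨hy, hcol⟩
      · rcases hcol with hcol | hcol
        · right
          exact hc.proper hy hvr (hcol.trans hrm.symm)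
        · exact absurd hcol (hθ y hy)
      · by_contra hyv
        have hyv' : y ≠ v := fun h => hyv (Or.inl h)
        rcases hcol with hcol | hcol
        · rw [Sym2.eq_swap] at hrm
          exact hyv' (hc.proper hy hvr.symm (hcol.trans hrm.symm))
        · exact hs.2 _ hvr hrS hrm y hyv' hy hcol
    rcases hmem with rfl | rfl
    · exact hn rfl
    · exact hvn hvr hrm

theorem ncard_neighborSet_diff {r : V} (hr : H.Adj v r) :
    (H.neighborSet r \ {v}).ncard + 1 = (H.neighborSet r).ncard :=
  Set.ncard_sdiff_singleton_add_one hr.symm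

theorem exists_unsafe_subset (h : IsCriticalConfig H k v u' w S) (hc : IsAcyclicColoring H c)
    (m : Fin k) : ∃ U : Set (Fin k), U.ncard ≤ 2 ∧ (m ≠ c s(v, w) → U.ncard ≤ 1) ∧
      ∀ θ, Missing H c v θ → θ ∉ U → Safe H c v S m θ := by
  by_cases hm : Missing H c v m
  · refine ⟨{m}, by simp, by simp, fun θ _ hU => ⟨fun h => hU h.symm, ?_⟩⟩
    exact fun r hr _ hrm => absurd hrm (hm r hr)
  obtain ⟨r, hvr, rfl⟩ := not_missing_iff.1 hm
  by_cases hrS : r ∈ S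
  · refine ⟨∅, by simp, by simp, fun θ hθ _ => ⟨hθ r hvr, fun q hq hqS hqm => ?_⟩⟩
    exact absurd (hc.proper hq hvr hqm ▸ hrS) hqS
  · have h1 := ncard_neighborSet_diff hvr
    have h2 : ((fun n => c s(r, n)) '' (H.neighborSet r \ {v})).ncard ≤ _ :=
      Set.ncard_image_le
    refine ⟨(fun n => c s(r, n)) '' (H.neighborSet r \ {v}), ?_, fun hw => ?_, 
      fun θ hθ hU => ⟨hθ r hvr, fun q hq hqS hqm n hn hrn hcol => ?_⟩⟩
    · have := h.ncard_low' hvr hrS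
      omega
    · have := h.ncard_low r hvr hrS (by rintro rfl; exact hw rfl)
      omega
    · obtain rfl := hc.proper hq hvr hqm
      exact hU ⟨n, ⟨hrn, hn⟩, hcol⟩

theorem exists_free_notMem (h : IsCriticalConfig H k v u' w S) (c : Sym2 V → Fin k)
    {U : Set (Fin k)} (hU : U.ncard ≤ 2) : ∃ θ, Missing H c v θ ∧ θ ∉ U :=
  Set.exists_mem_notMem_of_ncard_lt_ncard
    (lt_of_le_of_lt hU (lt_of_lt_of_le (by norm_num) (h.three_le_free_v c)))

variable [DecidableEq V]

theorem update_of_safe (h : IsCriticalConfig H k v u' w S) (hc : IsAcyclicColoring H c) {r : V}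
    (hr : H.Adj v r) {θ : Fin k} (hθ : Missing H c v θ)
    (hs : ∀ n, n ≠ v → H.Adj r n → Safe H c v S (c s(r, n)) θ) :
    IsAcyclicColoring H (Function.update c s(v, r) θ) := by
  have hle : H.deleteEdges {s(v, r)} ≤ H := deleteEdges_le _
  have hadj : ∀ n, (H.deleteEdges {s(v, r)}).Adj r n → n ≠ v ∧ H.Adj r n := by
    intro n hn
    rw [deleteEdges_adj] at hn
    refine ⟨?_, hn.1⟩
    rintro rfl
    exact hn.2 Sym2.eq_swap
  have hrθ : Missing H c r θ := by
    intro n hn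
    by_cases hnv : n = v
    · subst hnv
      rw [Sym2.eq_swap]
      exact hθ r hr
    · exact (hs n hnv hn).1
  refine (hc.anti hle).add_edge ?_ ?_ (hθ.anti hle) (hrθ.anti hle) ?_ hr.ne
  · intro p q hpq
    rw [deleteEdges_adj]
    by_cases he : s(p, q) = s(v, r)
    · exact Or.inr he
    · exact Or.inl ⟨hpq, he⟩
  · simp
  · intro m hm hreach
    by_cases hrm : Missing (H.deleteEdges {s(v, r)}) c r m
    · exact hr.ne (eq_of_reachable_of_missing hrm (hrθ.anti hle) hreach.symm)
    · obtain ⟨n, hn, rfl⟩ := not_missing_iff.1 hrm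
      obtain ⟨hnv, hrn⟩ := hadj n hn
      refine h.not_reachable_of_safe hc hθ (hs n hnv hrn) hr.ne' (Or.inr hrθ) ?_ ?_
        (hreach.mono (bicolored_mono hle _ _))
      · rintro hu rfl
        exact hu n hrn rfl
      · intro _ he
        rw [Sym2.eq_swap] at he
        exact hnv (hc.proper hr.symm hrn he).symm

theorem exists_update (h : IsCriticalConfig H k v u' w S) (hc : IsAcyclicColoring H c) {r : V}
    (hr : H.Adj v r) (hrS : r ∉ S) : ∃ θ, Missing H c v θ ∧
      IsAcyclicColoring H (Function.update c s(v, r) θ) := by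
  have hcard := ncard_neighborSet_diff hr
  have key : ∃ U : Set (Fin k), U.ncard ≤ 2 ∧ ∀ θ, Missing H c v θ → θ ∉ U →
      ∀ n, n ≠ v → H.Adj r n → Safe H c v S (c s(r, n)) θ := by
    by_cases hrw : r = w
    · subst hrw
      have h2 : (H.neighborSet r \ {v}).ncard ≤ 2 := by
        have := h.ncard_w
        omega
      obtain ⟨n₁, n₂, hsub⟩ : ∃ n₁ n₂, H.neighborSet r \ {v} ⊆ {n₁, n₂} := by
        rcases Nat.lt_or_ge (H.neighborSet r \ {v}).ncard 2 with h3 | h3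
        · rcases (Set.ncard_le_one_iff_eq).1 (Nat.le_of_lt_succ h3) with h4 | ⟨a, h4⟩
          · exact ⟨v, v, by simp [h4]⟩
          · exact ⟨a, a, by simp [h4]⟩
        · obtain ⟨a, b, _, hab⟩ := Set.ncard_eq_two.1 (le_antisymm h2 h3)
          exact ⟨a, b, hab.le⟩
      have hex : ∀ n, ∃ U : Set (Fin k), U.ncard ≤ 1 ∧ (n ≠ v → H.Adj r n →
          ∀ θ, Missing H c v θ → θ ∉ U → Safe H c v S (c s(r, n)) θ) := by
        intro n
        by_cases hn : n ≠ v ∧ H.Adj r n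
        · obtain ⟨U, -, hU, hs⟩ := h.exists_unsafe_subset hc (c s(r, n))
          refine ⟨U, hU ?_, fun _ _ => hs⟩
          intro he
          rw [Sym2.eq_swap (a := v)] at he
          exact hn.1 (hc.proper hn.2 hr.symm he)
        · exact ⟨∅, by simp, fun h1 h2 => absurd ⟨h1, h2⟩ hn⟩
      obtain ⟨U₁, hU₁, hs₁⟩ := hex n₁
      obtain ⟨U₂, hU₂, hs₂⟩ := hex n₂
      refine ⟨U₁ ∪ U₂, ?_, fun θ hθ hU n hn hrn => ?_⟩
      · have := Set.ncard_union_le U₁ U₂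
        omega
      · rw [Set.mem_union, not_or] at hU
        rcases hsub ⟨hrn, hn⟩ with rfl | rfl
        · exact hs₁ hn hrn θ hθ hU.1
        · exact hs₂ hn hrn θ hθ hU.2
    · have h1 : (H.neighborSet r \ {v}).ncard ≤ 1 := by
        have := h.ncard_low r hr hrS hrw
        omega
      rcases (Set.ncard_le_one_iff_eq).1 h1 with h4 | ⟨a, h4⟩
      · refine ⟨∅, by simp, fun θ _ _ n hn hrn => ?_⟩
        have : n ∈ H.neighborSet r \ {v} := ⟨hrn, hn⟩
        rw [h4] at this
        exact absurd this (Set.notMem_empty _)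
      · obtain ⟨U, hU, -, hs⟩ := h.exists_unsafe_subset hc (c s(r, a))
        refine ⟨U, hU, fun θ hθ hθU n hn hrn => ?_⟩
        have : n ∈ H.neighborSet r \ {v} := ⟨hrn, hn⟩
        rw [h4] at this
        obtain rfl := this
        exact hs θ hθ hθU
  obtain ⟨U, hU, hs⟩ := key
  obtain ⟨θ, hθ, hθU⟩ := h.exists_free_notMem c hU
  exact ⟨θ, hθ, h.update_of_safe hc hr hθ (hs θ hθ hθU)⟩

theorem not_missing_of_notMem (h : IsCriticalConfig H k v u' w S) (hc : IsAcyclicColoring H c)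
    {s : V} (hs : s ∈ S) {j : Fin k} (hj : ¬Missing H c u' j) : ¬Missing H c s j := by
  by_cases hjv : Missing H c v j
  · exact h.not_missing_of_missing hc (h.adj_S s hs) (h.missing_u' hc hs) hjv
  obtain ⟨r, hvr, rfl⟩ := not_missing_iff.1 hjv
  have hrS : r ∉ S := fun hrS => hj (h.missing_u' hc hrS)
  obtain ⟨θ, hθ, hc'⟩ := h.exists_update hc hvr hrS
  have hsr : s ≠ r := fun e => hrS (e ▸ hs)
  have hne : ∀ y, s(s, y) ≠ s(v, r) := by
    intro y e
    rcases Sym2.eq_iff.1 e with ⟨rfl, rfl⟩ | ⟨rfl, rfl⟩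
    exacts [(h.adj_S _ hs).ne rfl, hsr rfl]
  have hfree : Missing H (Function.update c s(v, r) θ) v (c s(v, r)) := by
    intro y hy
    by_cases hyr : y = r
    · subst hyr
      rw [Function.update_self]
      exact (hθ y hvr).symm
    · rw [Function.update_of_ne (fun e => hyr (Sym2.congr_right.1 e))]
      exact fun e => hyr (hc.proper hy hvr e)
  have := h.not_missing_of_missing hc' (h.adj_S s hs) (h.missing_u' hc' hs) hfree
  intro hm
  refine this fun y hy => ?_
  rw [Function.update_of_ne (hne y)]
  exact hm y hy

theorem missing_of_mem (h : IsCriticalConfig H k v u' w S) (hc : IsAcyclicColoring H c)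
    {s s' : V} (hs : s ∈ S) (hs' : s' ∈ S) (hne : s ≠ s') : Missing H c s (c s(v, s')) := by
  by_contra hm
  have h1 : insert (c s(v, s)) (insert (c s(v, s')) (freeColors H c u')ᶜ) ⊆
      (freeColors H c s)ᶜ := by
    rintro a (rfl | rfl | ha)
    · exact fun hm => hm v (h.adj_S s hs).symm (by rw [Sym2.eq_swap])
    · exact hm
    · exact h.not_missing_of_notMem hc hs ha
  have h2 := Set.ncard_le_ncard h1
  rw [Set.ncard_insert_of_notMem, Set.ncard_insert_of_notMem] at h2
  · have h3 := Set.ncard_add_ncard_compl (freeColors H c u')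
    rw [Nat.card_eq_fintype_card, Fintype.card_fin, h.ncard_free_u' hc] at h3
    have h4 := ncard_compl_freeColors_le H c s
    have h5 := h.ncard_le s
    omega
  · exact fun hx => hx (h.missing_u' hc hs')
  · rintro (he | hx)
    · exact hne (hc.proper (h.adj_S s hs) (h.adj_S s' hs') he)
    · exact hx (h.missing_u' hc hs)

theorem exists_recolor_low (h : IsCriticalConfig H k v u' w S) (hc : IsAcyclicColoring H c)
    {l : V} (hl : l ∈ lowVerts H v w S) {a b : Fin k} (ha : Missing H c u' a)
    (hb : Missing H c u' b) :
    ∃ c' : Sym2 V → Fin k, IsAcyclicColoring H c' ∧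
      (∀ p q, p ≠ l → q ≠ l → c' s(p, q) = c s(p, q)) ∧
      ∀ n, n ≠ v → H.Adj l n → c' s(l, n) ≠ a ∧ c' s(l, n) ≠ b := by
  obtain ⟨hvl, hlS, hlw⟩ := hl
  by_cases hgood : ∀ n, n ≠ v → H.Adj l n → c s(l, n) ≠ a ∧ c s(l, n) ≠ b
  · exact ⟨c, hc, fun _ _ _ _ => rfl, hgood⟩
  push Not at hgood
  obtain ⟨l', hl'v, hll', hcol⟩ := hgood
  have hcol' : c s(l, l') = a ∨ c s(l, l') = b := by
    by_cases hca : c s(l, l') = a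
    exacts [Or.inl hca, Or.inr (hcol hca)]
  have hnbr : ∀ n, n ≠ v → H.Adj l n → n = l' := by
    intro n hn hln
    by_contra hne
    have hsub : insert n {l', v} ⊆ H.neighborSet l := by
      rintro x (rfl | rfl | rfl)
      exacts [hln, hll', hvl.symm]
    have h1 := Set.ncard_le_ncard hsub
    rw [Set.ncard_insert_of_notMem (by simp [hn, hne]), Set.ncard_pair hl'v] at h1
    have := h.ncard_low l hvl hlS hlw
    omega
  have hul' : l' ≠ u' := by
    rintro rfl
    rw [Sym2.eq_swap] at hcol'
    rcases hcol' with e | e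
    exacts [ha l hll'.symm e, hb l hll'.symm e]
  have hle : H.deleteIncidenceSet l ≤ H := H.deleteIncidenceSet_le l
  obtain ⟨m, hm, hmab⟩ : ∃ m, m ∈ freeColors (H.deleteIncidenceSet l) c l' ∧
      m ∉ ({a, b} : Set (Fin k)) := by
    refine Set.exists_mem_notMem_of_ncard_lt_ncard ?_
    have h1 := le_ncard_freeColors (H.deleteIncidenceSet l) c l'
    have h2 := Set.ncard_sdiff_singleton_add_one (s := H.neighborSet l') (a := l) hll'.symm
    have h3 : ((H.deleteIncidenceSet l).neighborSet l').ncard ≤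
        (H.neighborSet l' \ {l}).ncard := by
      refine Set.ncard_le_ncard fun x hx => ?_
      have hx' := (H.deleteIncidenceSet_adj).1 hx
      exact ⟨hx'.1, hx'.2.2⟩
    have h4 := h.ncard_le l'
    have h5 : ({a, b} : Set (Fin k)).ncard ≤ 2 := Set.ncard_insert_le a {b} |>.trans (by simp)
    omega
  simp only [Set.mem_insert_iff, Set.mem_singleton_iff, not_or] at hmab
  have hl'm : Missing H c l' m := by
    intro y hy
    by_cases hyl : y = l
    · subst hyl
      rw [Sym2.eq_swap]
      rcases hcol' with e | e
      · exact fun e' => hmab.1 (e'.symm.trans e)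
      · exact fun e' => hmab.2 (e'.symm.trans e)
    · exact hm y (H.deleteIncidenceSet_adj.2 ⟨hy, hll'.ne', hyl⟩)
  obtain ⟨U, hU, -, hsafe⟩ := h.exists_unsafe_subset hc m
  obtain ⟨θ, hθ, hθU⟩ := h.exists_free_notMem c hU
  have hs := hsafe θ hθ hθU
  have hnr := h.not_reachable_of_safe hc hθ hs hl'v (Or.inl hl'm) (fun _ => hul')
    (fun hv => by rw [Sym2.eq_swap]; exact hl'm v hv.symm)
  refine ⟨_, (hc.anti hle).add_path (l := l) (l' := l') (m := m) (θ := θ) ?_ hvl.ne hll'.ne hl'v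
    ?_ hm (hθ.anti hle) hs.1 (fun hr => hnr (hr.mono (bicolored_mono hle _ _))), ?_, ?_⟩
  · intro y hy
    exact (H.deleteIncidenceSet_adj.1 hy).2.1 rfl
  · intro p q hpq
    rw [H.deleteIncidenceSet_adj]
    have key : ∀ q, H.Adj l q → s(l, q) = s(l, l') ∨ s(l, q) = s(v, l) := by
      intro q hq
      by_cases hqv : q = v
      · exact Or.inr (hqv ▸ Sym2.eq_swap)
      · exact Or.inl (by rw [hnbr q hqv hq])
    by_cases hp : p = l
    · subst hp
      exact Or.inr (key q hpq)
    by_cases hq : q = l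
    · subst hq
      rw [Sym2.eq_swap]
      exact Or.inr (key p hpq.symm)
    · exact Or.inl ⟨hpq, hp, hq⟩
  · intro p q hp hq
    have hne : ∀ x, s(p, q) ≠ s(l, x) := by
      intro x e
      rcases Sym2.eq_iff.1 e with ⟨e, -⟩ | ⟨-, e⟩
      exacts [hp e, hq e]
    rw [Function.update_of_ne (by rw [Sym2.eq_swap (a := v)]; exact hne v),
      Function.update_of_ne (hne l')]
  · intro n hn hln
    obtain rfl := hnbr n hn hln
    rw [Function.update_of_ne (fun e => hn (Sym2.congr_right.1 (e.trans Sym2.eq_swap))),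
      Function.update_self]
    exact hmab

theorem exists_recolor_lowVerts (h : IsCriticalConfig H k v u' w S) (hc : IsAcyclicColoring H c)
    {s s' : V} (hs : s ∈ S) (hs' : s' ∈ S) :
    ∃ c' : Sym2 V → Fin k, IsAcyclicColoring H c' ∧
      (∀ p q, p ∉ lowVerts H v w S → q ∉ lowVerts H v w S → c' s(p, q) = c s(p, q)) ∧
      ∀ l ∈ lowVerts H v w S, ∀ n, n ≠ v → H.Adj l n →
        c' s(l, n) ≠ c' s(v, s) ∧ c' s(l, n) ≠ c' s(v, s') := by
  have hvL : v ∉ lowVerts H v w S := fun hv => hv.1.ne rfl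
  have hSL : ∀ s ∈ S, s ∉ lowVerts H v w S := fun s hs hsL => hsL.2.1 hs
  have key : ∀ F : Set V, F.Finite → F ⊆ lowVerts H v w S →
      ∃ c' : Sym2 V → Fin k, IsAcyclicColoring H c' ∧
      (∀ p q, p ∉ lowVerts H v w S → q ∉ lowVerts H v w S → c' s(p, q) = c s(p, q)) ∧
      ∀ l ∈ F, ∀ n, n ≠ v → H.Adj l n →
        c' s(l, n) ≠ c s(v, s) ∧ c' s(l, n) ≠ c s(v, s') := by
    intro F hF
    induction F, hF using Set.Finite.induction_on with
    | empty => exact fun _ => ⟨c, hc, fun _ _ _ _ => rfl, by simp⟩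
    | @insert l F hl _ ih =>
      intro hsub
      obtain ⟨c₁, hc₁, hagree, hF⟩ := ih ((Set.subset_insert _ _).trans hsub)
      have hlL : l ∈ lowVerts H v w S := hsub (Set.mem_insert _ _)
      have hfree : ∀ s ∈ S, Missing H c₁ u' (c s(v, s)) := by
        intro s hs
        rw [← hagree v s hvL (hSL s hs)]
        exact h.missing_u' hc₁ hs
      obtain ⟨c₂, hc₂, hagree₂, hl₂⟩ := h.exists_recolor_low hc₁ hlL (hfree s hs) (hfree s' hs')
      refine ⟨c₂, hc₂, fun p q hp hq => ?_, ?_⟩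
      · rw [hagree₂ p q (fun e => hp (e ▸ hlL)) (fun e => hq (e ▸ hlL)), hagree p q hp hq]
      · intro r hr n hn hrn
        by_cases hrl : r = l
        · exact hrl ▸ hl₂ n hn (hrl ▸ hrn)
        have hrF : r ∈ F := (Set.mem_insert_iff.1 hr).resolve_left hrl
        have hrv : r ≠ v := fun e => hvL (e ▸ hsub hr)
        by_cases hnl : n = l
        · subst hnl
          rw [Sym2.eq_swap]
          exact hl₂ r hrv hrn.symm
        · rw [hagree₂ r n hrl hnl]
          exact hF r hrF n hn hrn
  obtain ⟨c', hc', hagree, hL⟩ := key _ (Set.toFinite _) subset_rfl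
  refine ⟨c', hc', hagree, ?_⟩
  rw [hagree v s hvL (hSL s hs), hagree v s' hvL (hSL s' hs')]
  exact hL

theorem not_reachable_of_core (h : IsCriticalConfig H k v u' w S) (hc : IsAcyclicColoring H c)
    {s s' : V} (hs : s ∈ S) (hs' : s' ∈ S) (hne : s ≠ s') {H₀ : SimpleGraph V} (hle : H₀ ≤ H)
    (hvs : ¬H₀.Adj v s) (hvs' : ¬H₀.Adj v s')
    (hlow : ∀ l ∈ lowVerts H v w S, ∀ n, n ≠ v → H.Adj l n → c s(l, n) ≠ c s(v, s'))
    (hcore : ¬(bicolored (core H v w S) c (c s(v, w)) (c s(v, s'))).Reachable w s)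
    (m : Fin k) : ¬(bicolored H₀ c m (c s(v, s'))).Reachable v s := by
  intro hr
  have hvs_ne : v ≠ s := (h.adj_S s hs).ne
  have hvb : Missing H₀ c v (c s(v, s')) := by
    intro y hy e
    obtain rfl := hc.proper (hle hy) (h.adj_S s' hs') e
    exact hvs' hy
  by_cases hm : Missing H c u' m
  · obtain ⟨t, ht, rfl⟩ := h.exists_mem_of_missing hc hm
    refine hvs_ne (eq_of_reachable_of_missing ?_ ((h.missing_of_mem hc hs hs' hne).anti hle)
      hr.symm)
    by_cases hst : s = t
    · subst hst
      intro y hy e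
      rw [Sym2.eq_swap (a := v)] at e
      obtain rfl := hc.proper (hle hy) (h.adj_S s hs).symm e
      exact hvs hy.symm
    · exact (h.missing_of_mem hc hs ht hst).anti hle
  by_cases hmv : Missing H₀ c v m
  · exact hvs_ne (eq_of_reachable_of_missing hmv hvb hr).symm
  obtain ⟨r, hvr, rfl⟩ := not_missing_iff.1 hmv
  have hrS : r ∉ S := fun hrS => hm (h.missing_u' hc hrS)
  have hvs'_ne : v ≠ s' := (h.adj_S s' hs').ne
  by_cases hrw : r = w
  · subst hrw
    refine hcore ?_
    have hadj : (bicolored H₀ c (c s(v, r)) (c s(v, s'))).Adj v r := ⟨hvr, Or.inl rfl⟩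
    refine (hadj.symm.reachable.trans hr).avoid_ends (R := insert v (lowVerts H v r S))
      ?_ ?_ ?_ ?_
    · rintro x (rfl | hx)
      · exact (hc.anti hle).isEnd_right hvb
      · have hxcol : ∀ y, (bicolored H₀ c (c s(v, r)) (c s(v, s'))).Adj x y →
            c s(x, y) = c s(v, r) := by
          rintro y ⟨hy, e | e⟩
          · exact e
          · by_cases hyv : y = v
            · subst hyv
              rw [Sym2.eq_swap] at e
              obtain rfl := hc.proper (hle hy).symm (h.adj_S s' hs') e
              exact absurd hs' hx.2.1
            · exact absurd e (hlow x hx y hyv (hle hy))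
        intro y z hy hz
        exact hc.proper (hle hy.1) (hle hz.1) ((hxcol y hy).trans (hxcol z hz).symm)
    · exact fun x y hxy hx hy => ⟨⟨hle hxy.1, hx, hy⟩, hxy.2⟩
    · rintro (e | e)
      exacts [hvr.ne e.symm, e.2.2 rfl]
    · rintro (e | e)
      exacts [hvs_ne e.symm, e.2.1 hs]
  · have hmem : s ∈ ({v, r} : Set V) := by
      refine hr.mem_of_closed ?_ (by simp)
      rintro x (rfl | rfl) y ⟨hy, hcol⟩
      · rcases hcol with hcol | hcol
        · exact Or.inr (hc.proper (hle hy) (hle hvr) hcol)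
        · exact absurd hcol (hvb y hy)
      · by_contra hyv
        have hyv' : y ≠ v := fun h => hyv (Or.inl h)
        rcases hcol with hcol | hcol
        · rw [Sym2.eq_swap (a := v)] at hcol
          exact hyv' (hc.proper (hle hy) (hle hvr).symm hcol)
        · exact hlow _ ⟨hle hvr, hrS, hrw⟩ y hyv' (hle hy) hcol
    rcases hmem with rfl | rfl
    exacts [hvs_ne rfl, hrS hs]

/-- Exchanging the colors of `v s` and `v s'` contradicts criticality. -/
theorem false_of_not_reachable_core (h : IsCriticalConfig H k v u' w S)
    (hc : IsAcyclicColoring H c) {s s' : V} (hs : s ∈ S) (hs' : s' ∈ S) (hne : s ≠ s')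
    (hlow : ∀ l ∈ lowVerts H v w S, ∀ n, n ≠ v → H.Adj l n →
      c s(l, n) ≠ c s(v, s) ∧ c s(l, n) ≠ c s(v, s'))
    (hcore : ¬(bicolored (core H v w S) c (c s(v, w)) (c s(v, s'))).Reachable w s)
    (hcore' : ¬(bicolored (core H v w S) c (c s(v, w)) (c s(v, s))).Reachable w s') : False := by
  have hvs := h.adj_S s hs
  have hvs' := h.adj_S s' hs'
  have hab : c s(v, s) ≠ c s(v, s') := fun e => hne (hc.proper hvs hvs' e)
  have hedge : s(v, s) ≠ s(v, s') := fun e => hne (Sym2.congr_right.1 e)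
  set a := c s(v, s) with ha
  set b := c s(v, s') with hb
  set H₀ := H.deleteEdges {s(v, s), s(v, s')} with hH₀
  set H₁ := H.deleteEdges {s(v, s)} with hH₁
  have hadj₀ : ∀ {p q}, H₀.Adj p q ↔ H.Adj p q ∧ s(p, q) ≠ s(v, s) ∧ s(p, q) ≠ s(v, s') := by
    intro p q
    simp only [hH₀, deleteEdges_adj, Set.mem_insert_iff, Set.mem_singleton_iff, not_or, ne_eq]
  have hadj₁ : ∀ {p q}, H₁.Adj p q ↔ H.Adj p q ∧ s(p, q) ≠ s(v, s) := by
    intro p q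
    simp only [hH₁, deleteEdges_adj, Set.mem_singleton_iff, ne_eq]
  have hle₀ : H₀ ≤ H := deleteEdges_le _
  have hle₁ : H₁ ≤ H := deleteEdges_le _
  have hn₀ : ¬H₀.Adj v s := fun e => (hadj₀.1 e).2.1 rfl
  have hn₀' : ¬H₀.Adj v s' := fun e => (hadj₀.1 e).2.2 rfl
  have hsne : ∀ y, s(s, y) ≠ s(v, s') := by
    intro y e
    rcases Sym2.eq_iff.1 e with ⟨e, -⟩ | ⟨e, -⟩
    exacts [hvs.ne e.symm, hne e]
  have hva : ∀ y, H.Adj v y → c s(v, y) = a → y = s := fun y hy e => hc.proper hy hvs e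
  have hvb : ∀ y, H.Adj v y → c s(v, y) = b → y = s' := fun y hy e => hc.proper hy hvs' e
  set c₁ := Function.update c s(v, s') a with hc₁_def
  have hc₁_ne : ∀ e, e ≠ s(v, s') → c₁ e = c e := fun e he => Function.update_of_ne he _ _
  have hc₁_self : c₁ s(v, s') = a := Function.update_self _ _ _
  have hc₁ : IsAcyclicColoring H₁ c₁ := by
    refine (hc.anti hle₀).add_edge ?_ hn₀' ?_ ?_ ?_ hvs'.ne
    · intro p q hpq
      rw [hadj₁] at hpq
      by_cases e : s(p, q) = s(v, s')
      · exact Or.inr e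
      · exact Or.inl (hadj₀.2 ⟨hpq.1, hpq.2, e⟩)
    · intro y hy e
      exact hn₀ (hva y (hle₀ hy) e ▸ hy)
    · exact (h.missing_of_mem hc hs' hs hne.symm).anti hle₀
    · exact fun m _ => h.not_reachable_of_core hc hs' hs hne.symm hle₀ hn₀' hn₀
        (fun l hl n hn hln => (hlow l hl n hn hln).1) hcore' m
  set c' := Function.update c₁ s(v, s) b with hc'_def
  have hsb : Missing H₁ c₁ s b := by
    intro y hy
    rw [hc₁_ne _ (hsne y)]
    exact h.missing_of_mem hc hs hs' hne y (hle₁ hy)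
  have hc' : IsAcyclicColoring H c' := by
    refine hc₁.add_edge ?_ (fun e => (hadj₁.1 e).2 rfl) ?_ hsb ?_ hvs.ne
    · intro p q hpq
      by_cases e : s(p, q) = s(v, s)
      · exact Or.inr e
      · exact Or.inl (hadj₁.2 ⟨hpq, e⟩)
    · intro y hy
      by_cases e : s(v, y) = s(v, s')
      · rw [e, hc₁_self]
        exact hab
      · rw [hc₁_ne _ e]
        intro e'
        exact e (by rw [hvb y (hle₁ hy) e'])
    · intro m _ hr
      by_cases hma : m = a
      · refine hvs.ne (eq_of_reachable_of_missing (a := m) ?_ hsb hr.symm)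
        intro y hy e
        rw [hc₁_ne _ (hsne y), hma, ha, Sym2.eq_swap (a := v)] at e
        obtain rfl := hc.proper (hle₁ hy) hvs.symm e
        exact (hadj₁.1 hy).2 Sym2.eq_swap
      · refine h.not_reachable_of_core hc hs hs' hne hle₀ hn₀ hn₀'
          (fun l hl n hn hln => (hlow l hl n hn hln).2) hcore m (hr.mono ?_)
        rintro p q ⟨hpq, hcol⟩
        by_cases e : s(p, q) = s(v, s')
        · rw [e, hc₁_self] at hcol
          rcases hcol with e' | e'
          exacts [absurd e'.symm hma, absurd e' hab]
        · rw [hc₁_ne _ e] at hcol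
          exact ⟨hadj₀.2 ⟨(hadj₁.1 hpq).1, (hadj₁.1 hpq).2, e⟩, hcol⟩
  have hc'_ne : ∀ e, e ≠ s(v, s) → e ≠ s(v, s') → c' e = c e := by
    intro e he he'
    rw [hc'_def, Function.update_of_ne he, hc₁_ne e he']
  have hc's : c' s(v, s) = b := Function.update_self _ _ _
  have hc's' : c' s(v, s') = a := by
    rw [hc'_def, Function.update_of_ne hedge.symm, hc₁_self]
  obtain ⟨θ, hθ, -⟩ := h.exists_free_notMem c (U := ∅) (by simp)
  have hub : Missing H c u' b := h.missing_u' hc hs'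
  have hub' : Missing H c' u' b := by
    rw [← hc's]
    exact h.missing_u' hc' hs
  have hθ' : Missing H c' v θ := by
    intro y hy
    by_cases e : s(v, y) = s(v, s)
    · rw [e, hc's]
      exact hθ s' hvs'
    by_cases e' : s(v, y) = s(v, s')
    · rw [e', hc's']
      exact hθ s hvs
    · rw [hc'_ne _ e e']
      exact hθ y hy
  have hbθ : b ≠ θ := hθ s' hvs'
  have hreach := h.reachable c hc b θ hub hθ hbθ
  have hreach' := h.reachable c' hc' b θ hub' hθ' hbθ
  have hoff : ∀ p q t, p ≠ v → q ≠ v → s(p, q) ≠ s(v, t) := by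
    intro p q t hp hq e
    rcases Sym2.eq_iff.1 e with ⟨e, -⟩ | ⟨-, e⟩
    exacts [hp e, hq e]
  have hD' : (bicolored H₀ c b θ).Reachable s' u' := by
    have hadj : (bicolored H c b θ).Adj v s' := ⟨hvs', Or.inl rfl⟩
    refine (hadj.symm.reachable.trans hreach).avoid_ends (R := {v}) ?_ ?_ hvs'.ne' h.ne
    · rintro _ rfl
      exact hc.isEnd_right hθ
    · rintro p q ⟨hpq, hcol⟩ hp hq
      exact ⟨hadj₀.2 ⟨hpq, hoff p q s hp hq, hoff p q s' hp hq⟩, hcol⟩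
  have hD : (bicolored H₀ c b θ).Reachable s u' := by
    have hadj : (bicolored H c' b θ).Adj v s := ⟨hvs, Or.inl hc's⟩
    refine (hadj.symm.reachable.trans hreach').avoid_ends (R := {v}) ?_ ?_ hvs.ne' h.ne
    · rintro _ rfl
      exact hc'.isEnd_right hθ'
    · rintro p q ⟨hpq, hcol⟩ hp hq
      rw [hc'_ne _ (hoff p q s hp hq) (hoff p q s' hp hq)] at hcol
      exact ⟨hadj₀.2 ⟨hpq, hoff p q s hp hq, hoff p q s' hp hq⟩, hcol⟩
  have hc₀ := hc.anti hle₀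
  refine hne ((hc₀.atMostTwoNeighbors b θ).end_unique (hc₀.isEnd_left (hub.anti hle₀))
    (hc₀.isEnd_left ((h.missing_of_mem hc hs hs' hne).anti hle₀)) (hc₀.isEnd_left ?_)
    (h.ne_of_mem hc hs) (h.ne_of_mem hc hs') hD.symm hD'.symm)
  intro y hy e
  rw [hb, Sym2.eq_swap (a := v)] at e
  obtain rfl := hc.proper (hle₀ hy) hvs'.symm e
  exact hn₀' hy.symm

theorem exists_not_reachable_core (h : IsCriticalConfig H k v u' w S)
    (hc : IsAcyclicColoring H c) : ∃ s ∈ S, ∃ s' ∈ S, s ≠ s' ∧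
      ¬(bicolored (core H v w S) c (c s(v, w)) (c s(v, s'))).Reachable w s ∧
      ¬(bicolored (core H v w S) c (c s(v, w)) (c s(v, s))).Reachable w s' := by
  have hcore := hc.anti (core_le (H := H) (v := v) (S := S) (w := w))
  have hw : Missing (core H v w S) c w (c s(v, w)) := by
    intro y hy e
    rw [Sym2.eq_swap (a := v)] at e
    obtain rfl := hc.proper hy.1 h.adj_w.symm e
    exact hy.2.2 (Set.mem_insert _ _)
  have hws : ∀ s ∈ S, w ≠ s := fun s hs e => h.w_notMem (e ▸ hs)
  have uniq : ∀ s ∈ S, ∀ s' ∈ S, ∀ t ∈ S, s ≠ t → s' ≠ t →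
      (bicolored (core H v w S) c (c s(v, w)) (c s(v, t))).Reachable w s →
      (bicolored (core H v w S) c (c s(v, w)) (c s(v, t))).Reachable w s' → s = s' := by
    intro s hs s' hs' t ht hst hst' hr hr'
    exact (hcore.atMostTwoNeighbors _ _).end_unique (hcore.isEnd_left hw)
      (hcore.isEnd_right ((h.missing_of_mem hc hs ht hst).anti core_le))
      (hcore.isEnd_right ((h.missing_of_mem hc hs' ht hst').anti core_le))
      (hws s hs) (hws s' hs') hr hr'
  have nbr : ∀ s ∈ S, ∀ t,
      (bicolored (core H v w S) c (c s(v, w)) (c s(v, t))).Reachable w s →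
      ∃ n, n ≠ v ∧ H.Adj w n ∧ c s(w, n) = c s(v, t) := by
    intro s hs t hr
    by_contra hno
    refine hws s hs (eq_of_reachable_of_missing hw ?_ hr).symm
    intro y hy e
    exact hno ⟨y, fun e => hy.2.2 (e ▸ Set.mem_insert _ _), hy.1, e⟩
  obtain ⟨x, y, z, hxy, hxz, hyz, hS⟩ := Set.ncard_eq_three.1 (h.ncard_S_eq hc)
  have hx : x ∈ S := by simp [hS]
  have hy : y ∈ S := by simp [hS]
  have hz : z ∈ S := by simp [hS]
  have not_all : ∀ s₁ ∈ S, ∀ s₂ ∈ S, ∀ s₃ ∈ S,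
      (bicolored (core H v w S) c (c s(v, w)) (c s(v, x))).Reachable w s₁ →
      (bicolored (core H v w S) c (c s(v, w)) (c s(v, y))).Reachable w s₂ →
      (bicolored (core H v w S) c (c s(v, w)) (c s(v, z))).Reachable w s₃ → False := by
    intro s₁ h₁ s₂ h₂ s₃ h₃ hr₁ hr₂ hr₃
    obtain ⟨n₁, hn₁, ha₁, hcx⟩ := nbr s₁ h₁ x hr₁
    obtain ⟨n₂, hn₂, ha₂, hcy⟩ := nbr s₂ h₂ y hr₂
    obtain ⟨n₃, hn₃, ha₃, hcz⟩ := nbr s₃ h₃ z hr₃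
    have distinct : ∀ {p q n n'}, p ∈ S → q ∈ S → p ≠ q → c s(w, n) = c s(v, p) →
        c s(w, n') = c s(v, q) → n ≠ n' := by
      rintro p q n _ hp hq hpq e e' rfl
      exact hpq (hc.proper (h.adj_S p hp) (h.adj_S q hq) (e.symm.trans e'))
    have h12 := distinct hx hy hxy hcx hcy
    have h13 := distinct hx hz hxz hcx hcz
    have h23 := distinct hy hz hyz hcy hcz
    have hsub : insert v {n₁, n₂, n₃} ⊆ H.neighborSet w := by
      rintro p (rfl | rfl | rfl | rfl)
      exacts [h.adj_w.symm, ha₁, ha₂, ha₃]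
    have hcard := Set.ncard_le_ncard hsub
    rw [Set.ncard_insert_of_notMem (by simp [hn₁.symm, hn₂.symm, hn₃.symm]),
      Set.ncard_eq_three.2 ⟨n₁, n₂, n₃, h12, h13, h23, rfl⟩] at hcard
    have := h.ncard_w
    omega
  by_contra! hno
  have h1 := hno x hx y hy hxy
  have h2 := hno x hx z hz hxz
  have h3 := hno y hy z hz hyz
  have u1 := uniq y hy z hz x hx hxy.symm hxz.symm
  have u2 := uniq x hx z hz y hy hxy hyz.symm
  have u3 := uniq x hx y hy z hz hxz hyz
  have n1 := not_all y hy z hz x hx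
  have n2 := not_all z hz x hx y hy
  tauto

theorem not_isAcyclicColoring (h : IsCriticalConfig H k v u' w S) (c : Sym2 V → Fin k) :
    ¬IsAcyclicColoring H c := by
  intro hc
  obtain ⟨s, hs, s', hs', hne, hcore, hcore'⟩ := h.exists_not_reachable_core hc
  obtain ⟨c', hc', hagree, hlow⟩ := h.exists_recolor_lowVerts hc hs hs'
  have hvL : v ∉ lowVerts H v w S := fun hv => hv.1.ne rfl
  have hwL : w ∉ lowVerts H v w S := fun hw => hw.2.2 rfl
  have hSL : ∀ s ∈ S, s ∉ lowVerts H v w S := fun s hs hsL => hsL.2.1 hs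
  have hle : ∀ a b, bicolored (core H v w S) c' a b ≤ bicolored (core H v w S) c a b := by
    rintro a b p q ⟨hpq, hcol⟩
    rw [hagree p q (fun e => hpq.2.1 (Or.inr e)) (fun e => hpq.2.2 (Or.inr e))] at hcol
    exact ⟨hpq, hcol⟩
  refine h.false_of_not_reachable_core hc' hs hs' hne hlow (fun hr => hcore ?_)
    (fun hr => hcore' ?_)
  · rw [hagree v w hvL hwL, hagree v s' hvL (hSL s' hs')] at hr
    exact hr.mono (hle _ _)
  · rw [hagree v w hvL hwL, hagree v s hvL (hSL s hs)] at hr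
    exact hr.mono (hle _ _)

end IsCriticalConfig

end Configuration

end SimpleGraph

theorem SimpleGraph.ncard_neighborSet {V : Type*} [Fintype V] (G : SimpleGraph V)
    [DecidableRel G.Adj] (x : V) : (G.neighborSet x).ncard = G.degree x := by
  rw [Set.ncard_eq_toFinset_card']
  rfl

theorem SimpleGraph.exists_other_neighbor {V : Type*} [Fintype V] [DecidableEq V]
    {G : SimpleGraph V} [DecidableRel G.Adj] {u v : V} (huv : G.Adj u v) (hu : G.degree u = 2) :
    ∃ u', u' ≠ v ∧ G.Adj u u' ∧ ∀ x, G.Adj u x → x = v ∨ x = u' := by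
  rw [← G.card_neighborFinset_eq_degree, Finset.card_eq_two] at hu
  obtain ⟨x, y, hxy, he⟩ := hu
  have hmem : ∀ z, G.Adj u z ↔ z = x ∨ z = y := fun z => by
    rw [← G.mem_neighborFinset, he, Finset.mem_insert, Finset.mem_singleton]
  rcases (hmem v).1 huv with rfl | rfl
  · exact ⟨y, hxy.symm, (hmem y).2 (Or.inr rfl), fun z hz => (hmem z).1 hz⟩
  · exact ⟨x, hxy, (hmem x).2 (Or.inl rfl), fun z hz => ((hmem z).1 hz).symm⟩

theorem SimpleGraph.ncard_neighborSet_deleteIncidenceSet_le {V : Type*} [Fintype V]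
    [DecidableEq V] (G : SimpleGraph V) [DecidableRel G.Adj] (u x : V) :
    ((G.deleteIncidenceSet u).neighborSet x).ncard ≤ G.degree x := by
  rw [← G.ncard_neighborSet]
  exact Set.ncard_le_ncard fun y hy => G.deleteIncidenceSet_le u hy

theorem SimpleGraph.ncard_neighborSet_deleteIncidenceSet_lt {V : Type*} [Fintype V]
    [DecidableEq V] (G : SimpleGraph V) [DecidableRel G.Adj] {u x : V} (h : G.Adj x u) :
    ((G.deleteIncidenceSet u).neighborSet x).ncard < G.degree x := by
  rw [← G.ncard_neighborSet]
  refine Set.ncard_lt_ncard (Set.ssubset_iff_of_subset ?_ |>.2 ⟨u, h, fun hu => ?_⟩)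
  · exact fun y hy => G.deleteIncidenceSet_le u hy
  · exact (G.deleteIncidenceSet_adj.1 hu).2.2 rfl

/-- Removing a neighbor `u` of degree two from a critical graph leaves the two neighbors of `u`
joined by a path in every pair of colors missing at one neighbor each. -/
theorem SimpleGraph.reachable_of_critical {V : Type*} [DecidableEq V] {G : SimpleGraph V} {k : ℕ}
    (hG : ¬AcyclicEdgeColorable G k) {u v u' : V} (hvu : G.Adj v u) (huu' : G.Adj u u')
    (hne : u' ≠ v) (hu : ∀ x, G.Adj u x → x = v ∨ x = u') {c : Sym2 V → Fin k}
    (hc : IsAcyclicColoring (G.deleteIncidenceSet u) c) {a θ : Fin k}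
    (ha : Missing (G.deleteIncidenceSet u) c u' a)
    (hθ : Missing (G.deleteIncidenceSet u) c v θ) (haθ : a ≠ θ) :
    (bicolored (G.deleteIncidenceSet u) c a θ).Reachable v u' := by
  by_contra hr
  refine hG ⟨_, isAcyclicEdgeColoring_iff.2 (hc.add_path (H := G) (l := u)
    (fun y hy => (G.deleteIncidenceSet_adj.1 hy).2.1 rfl) hvu.ne huu'.ne hne ?_ ha hθ haθ hr)⟩
  intro p q hpq
  by_cases hp : p = u
  · subst hp
    rcases hu q hpq with rfl | rfl
    exacts [Or.inr (Or.inr Sym2.eq_swap), Or.inr (Or.inl rfl)]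
  by_cases hq : q = u
  · subst hq
    rcases hu p hpq.symm with rfl | rfl
    exacts [Or.inr (Or.inr rfl), Or.inr (Or.inl Sym2.eq_swap)]
  exact Or.inl (G.deleteIncidenceSet_adj.2 ⟨hpq, hp, hq⟩)

theorem stmt15 {V : Type*} [Fintype V] [DecidableEq V] (G : SimpleGraph V) [DecidableRel G.Adj]
    (hG : IsAcyclicallyEdgeCritical G (G.maxDegree + 2))
    (v : V) (t : ℕ) (hv : G.degree v = t) (ht : 5 ≤ t)
    (h2 : ((G.neighborFinset v).filter fun w => G.degree w = 2).card = t - 4) :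
    ((G.neighborFinset v).filter fun w => G.degree w = 3).card = 0 := by
  by_contra h3
  obtain ⟨w, hw⟩ := Finset.card_pos.1 (Nat.pos_of_ne_zero h3)
  obtain ⟨u, hu⟩ := Finset.card_pos.1 (show 0 < _ by rw [h2]; omega)
  simp only [Finset.mem_filter, mem_neighborFinset] at hw hu
  obtain ⟨hvw, hdw⟩ := hw
  obtain ⟨hvu, hdu⟩ := hu
  obtain ⟨u', hne, huu', hunbr⟩ := exists_other_neighbor hvu.symm hdu
  have hlt : G.deleteIncidenceSet u < G := by
    refine lt_of_le_of_ne (G.deleteIncidenceSet_le u) fun e => ?_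
    have hadj : (G.deleteIncidenceSet u).Adj v u := by rw [e]; exact hvu
    exact (G.deleteIncidenceSet_adj.1 hadj).2.2 rfl
  obtain ⟨c, hc⟩ := hG.2 _ hlt
  let T := ((G.neighborFinset v).filter fun x => ¬G.degree x = 2).erase w
  have hT : ∀ x, x ∈ T ↔ x ≠ w ∧ G.Adj v x ∧ G.degree x ≠ 2 := fun x => by simp [T]
  have hTcard : T.card ≤ 3 := by
    have h := Finset.card_filter_add_card_filter_not (s := G.neighborFinset v)
      (fun x => G.degree x = 2)
    rw [h2, G.card_neighborFinset_eq_degree, hv] at h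
    have hcard : T.card = _ - 1 := Finset.card_erase_of_mem (by simp [hvw, hdw])
    omega
  have hle := fun x => G.ncard_neighborSet_deleteIncidenceSet_le u x
  have hmax := fun x => G.degree_le_maxDegree x
  refine IsCriticalConfig.not_isAcyclicColoring (H := G.deleteIncidenceSet u) (v := v) (u' := u')
    (w := w) (S := (T : Set V)) ?_ c (isAcyclicEdgeColoring_iff.1 hc)
  exact
    { reachable := fun c hc a θ ha hθ haθ =>
        reachable_of_critical hG.1 hvu huu' hne hunbr hc ha hθ haθ
      ne := hne
      ncard_v := by
        have := G.ncard_neighborSet_deleteIncidenceSet_lt hvu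
        have := hmax v
        omega
      ncard_u' := by
        have := G.ncard_neighborSet_deleteIncidenceSet_lt huu'.symm
        have := hmax u'
        omega
      ncard_le := fun x => Nat.add_le_add_right ((hle x).trans (hmax x)) 2
      adj_S := fun s hs => by
        have hs' := (hT s).1 (Finset.mem_coe.1 hs)
        refine G.deleteIncidenceSet_adj.2 ⟨hs'.2.1, hvu.ne, ?_⟩
        rintro rfl
        exact hs'.2.2 hdu
      ncard_S := by rwa [Set.ncard_coe_finset]
      adj_w := by
        refine G.deleteIncidenceSet_adj.2 ⟨hvw, hvu.ne, ?_⟩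
        rintro rfl
        omega
      w_notMem := fun h => ((hT w).1 (Finset.mem_coe.1 h)).1 rfl
      ncard_w := (hle w).trans hdw.le
      ncard_low := fun r hr hrS hrw => by
        refine (hle r).trans (le_of_eq ?_)
        by_contra hdr
        exact hrS (Finset.mem_coe.2 ((hT r).2 ⟨hrw, G.deleteIncidenceSet_le u hr, hdr⟩)) }
end

section
/- Let G be an acyclically edge (Δ(G)+2)-critical finite simple graph, and let v be a vertex of degree 5. Then the number of neighbors of v of degree 2 plus the number of neighbors of v of degree 3 is at most 3. -/
open SimpleGraph

theorem Finset.exists_mem_notMem_of_card_le_of_lt {α : Type*} {M F : Finset α} {m n : ℕ} (hM : n ≤ M.card)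
    (hF : F.card ≤ m) (h : m < n) : ∃ x ∈ M, x ∉ F :=
  Finset.exists_mem_notMem_of_card_lt_card (by omega)

section Choosing

variable {α : Type*} [DecidableEq α]

/-- Three colors avoiding prescribed lists, no two of them lying in each other's list. -/
theorem exists_three_colors {M F₀ F₁ F₂ : Finset α} (hM : 5 ≤ M.card)
    (h₀ : F₀.card ≤ 2) (h₁ : F₁.card ≤ 2) (h₂ : F₂.card ≤ 2) :
    ∃ a ∈ M, ∃ b ∈ M, ∃ d ∈ M, a ≠ b ∧ a ≠ d ∧ b ≠ d ∧ a ∉ F₀ ∧ b ∉ F₁ ∧ d ∉ F₂ ∧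
      ¬ (a ∈ F₁ ∧ b ∈ F₀) ∧ ¬ (a ∈ F₂ ∧ d ∈ F₀) ∧ ¬ (b ∈ F₂ ∧ d ∈ F₁) := by
  by_cases hp : ∃ p ∈ M, p ∉ F₀ ∧ p ∉ F₁ ∧ p ∉ F₂
  · obtain ⟨p, hpM, hp0, hp1, hp2⟩ := hp
    have last : ∀ (F : Finset α) (q : α), F.card ≤ 2 → ∃ x ∈ M, x ∉ insert p (insert q F) := by
      intro F q hF
      refine Finset.exists_mem_notMem_of_card_le_of_lt (m := 4) hM ?_ (by norm_num)
      have := Finset.card_insert_le p (insert q F)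
      have := Finset.card_insert_le q F
      omega
    by_cases h12 : ∃ q ∈ M, q ≠ p ∧ q ∉ F₁ ∧ q ∉ F₂
    · obtain ⟨q, hqM, hqp, hq1, hq2⟩ := h12
      obtain ⟨x, hxM, hx⟩ := last F₂ q h₂
      simp only [Finset.mem_insert, not_or] at hx
      exact ⟨p, hpM, q, hqM, x, hxM, by grind⟩
    by_cases h02 : ∃ q ∈ M, q ≠ p ∧ q ∉ F₀ ∧ q ∉ F₂
    · obtain ⟨q, hqM, hqp, hq0, hq2⟩ := h02
      obtain ⟨x, hxM, hx⟩ := last F₂ q h₂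
      simp only [Finset.mem_insert, not_or] at hx
      exact ⟨q, hqM, p, hpM, x, hxM, by grind⟩
    by_cases h01 : ∃ q ∈ M, q ≠ p ∧ q ∉ F₀ ∧ q ∉ F₁
    · obtain ⟨q, hqM, hqp, hq0, hq1⟩ := h01
      obtain ⟨x, hxM, hx⟩ := last F₁ q h₁
      simp only [Finset.mem_insert, not_or] at hx
      exact ⟨q, hqM, x, hxM, p, hpM, by grind⟩
    exfalso
    have hcover : M.erase p ⊆ (F₀ ∩ F₁) ∪ F₂ := by
      intro q hq
      grind
    have hcover' : M.erase p ⊆ F₀ ∪ F₁ := by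
      intro q hq
      grind
    have e1 := Finset.card_le_card hcover
    have e2 := Finset.card_le_card hcover'
    have e3 := Finset.card_union_le (F₀ ∩ F₁) F₂
    have e4 := Finset.card_union_add_card_inter F₀ F₁
    have e5 := Finset.pred_card_le_card_erase (s := M) (a := p)
    omega
  · have priv : ∀ F F' : Finset α, F.card ≤ 2 → F'.card ≤ 2 → ∃ x ∈ M, x ∉ F ∪ F' := by
      intro F F' hF hF'
      refine Finset.exists_mem_notMem_of_card_le_of_lt (m := 4) hM ?_ (by norm_num)
      have := Finset.card_union_le F F'
      omega
    obtain ⟨x, hxM, hx⟩ := priv F₀ F₂ h₀ h₂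
    obtain ⟨y, hyM, hy⟩ := priv F₀ F₁ h₀ h₁
    obtain ⟨z, hzM, hz⟩ := priv F₁ F₂ h₁ h₂
    simp only [Finset.mem_union, not_or] at hx hy hz
    exact ⟨x, hxM, y, hyM, z, hzM, by grind⟩

/-- A variant of `exists_three_colors` in which one of the lists may be longer, provided that only
one of its elements matters for the symmetric condition. -/
theorem exists_three_colors_of_card_le_three {M F₀ A₀ F₁ F₂ : Finset α} (hM : 5 ≤ M.card)
    (h₀ : F₀.card ≤ 3) (hA₀ : A₀ ⊆ F₀) (hA₀' : A₀.card ≤ 1)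
    (h₁ : F₁.card ≤ 2) (h₂ : F₂.card ≤ 2) :
    ∃ a ∈ M, ∃ b ∈ M, ∃ d ∈ M, a ≠ b ∧ a ≠ d ∧ b ≠ d ∧ a ∉ F₀ ∧ b ∉ F₁ ∧ d ∉ F₂ ∧
      ¬ (a ∈ F₁ ∧ b ∈ A₀) ∧ ¬ (a ∈ F₂ ∧ d ∈ A₀) ∧ ¬ (b ∈ F₂ ∧ d ∈ F₁) := by
  have hU := Finset.card_union_le F₁ F₂
  by_cases hs : ∃ s ∈ M, s ∉ F₁ ∧ s ∉ F₂ ∧ s ∉ A₀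
  · obtain ⟨s, hsM, hs1, hs2, hsA⟩ := hs
    obtain ⟨p, hpM, hp⟩ : ∃ p ∈ M, p ∉ insert s F₀ := by
      refine Finset.exists_mem_notMem_of_card_le_of_lt (m := 4) hM ?_ (by norm_num)
      have := Finset.card_insert_le s F₀
      omega
    simp only [Finset.mem_insert, not_or] at hp
    by_cases hp2 : p ∈ F₂
    · obtain ⟨x, hxM, hx⟩ : ∃ x ∈ M, x ∉ insert s (F₂ ∪ A₀) := by
        refine Finset.exists_mem_notMem_of_card_le_of_lt (m := 4) hM ?_ (by norm_num)
        have := Finset.card_insert_le s (F₂ ∪ A₀)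
        have := Finset.card_union_le F₂ A₀
        omega
      simp only [Finset.mem_insert, Finset.mem_union, not_or] at hx
      exact ⟨p, hpM, s, hsM, x, hxM, by grind⟩
    · obtain ⟨x, hxM, hx⟩ : ∃ x ∈ M, x ∉ insert s (insert p F₂) := by
        refine Finset.exists_mem_notMem_of_card_le_of_lt (m := 4) hM ?_ (by norm_num)
        have := Finset.card_insert_le s (insert p F₂)
        have := Finset.card_insert_le p F₂
        omega
      simp only [Finset.mem_insert, not_or] at hx
      exact ⟨p, hpM, s, hsM, x, hxM, by grind⟩
  · obtain ⟨s, hsM, hs'⟩ : ∃ s ∈ M, s ∉ F₁ ∪ F₂ :=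
      Finset.exists_mem_notMem_of_card_le_of_lt (m := 4) hM (by omega) (by norm_num)
    simp only [Finset.mem_union, not_or] at hs'
    have hsA : s ∈ A₀ := by grind
    have hA : ∀ x ∈ A₀, x = s := fun x hx => Finset.card_le_one.1 hA₀' x hx s hsA
    obtain ⟨p, hpM, hp⟩ := Finset.exists_mem_notMem_of_card_le_of_lt hM h₀ (by norm_num)
    have last : ∀ F : Finset α, F.card ≤ 2 → ∃ x ∈ M, x ∉ insert s (insert p F) := by
      intro F hF
      refine Finset.exists_mem_notMem_of_card_le_of_lt (m := 4) hM ?_ (by norm_num)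
      have := Finset.card_insert_le s (insert p F)
      have := Finset.card_insert_le p F
      omega
    have hdisj : ¬ (p ∈ F₁ ∧ p ∈ F₂) := by
      rintro ⟨hp1, hp2⟩
      have hsub : M.erase s ⊆ F₁ ∪ F₂ := by
        intro x hx
        grind
      have e1 := Finset.card_le_card hsub
      have e2 := Finset.card_union_add_card_inter F₁ F₂
      have e3 : 0 < (F₁ ∩ F₂).card := Finset.card_pos.2 ⟨p, Finset.mem_inter.2 ⟨hp1, hp2⟩⟩
      have e4 := Finset.pred_card_le_card_erase (s := M) (a := s)
      omega
    by_cases hp2 : p ∈ F₂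
    · obtain ⟨x, hxM, hx⟩ := last F₂ h₂
      simp only [Finset.mem_insert, not_or] at hx
      exact ⟨p, hpM, s, hsM, x, hxM, by grind⟩
    · obtain ⟨x, hxM, hx⟩ := last F₁ h₁
      simp only [Finset.mem_insert, not_or] at hx
      exact ⟨p, hpM, x, hxM, s, hsM, by grind⟩

/-- The common form of `exists_three_colors` and `exists_three_colors_of_card_le_three`. -/
theorem exists_three_colors_of_forbidden {ι : Type*} {M : Finset α} {A B : ι → Finset α}
    {i j k : ι}
    (hM : 5 ≤ M.card) (hA : ∀ x, x = i ∨ x = j ∨ x = k → (A x).card ≤ 2)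
    (hB : ∀ x, x = i ∨ x = j ∨ x = k → B x ≠ ∅ → (A x).card ≤ 1)
    (hcard : ∀ x, x = i ∨ x = j ∨ x = k → (B x).card ≤ 2)
    (hij : 2 ≤ (B i).card → B j = ∅) (hik : 2 ≤ (B i).card → B k = ∅)
    (hji : 2 ≤ (B j).card → B i = ∅) (hjk : 2 ≤ (B j).card → B k = ∅)
    (hki : 2 ≤ (B k).card → B i = ∅) (hkj : 2 ≤ (B k).card → B j = ∅) :
    ∃ a ∈ M, ∃ b ∈ M, ∃ d ∈ M, a ≠ b ∧ a ≠ d ∧ b ≠ d ∧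
      a ∉ A i ∪ B i ∧ b ∉ A j ∪ B j ∧ d ∉ A k ∪ B k ∧
      ¬ (a ∈ A j ∧ b ∈ A i) ∧ ¬ (a ∈ A k ∧ d ∈ A i) ∧ ¬ (b ∈ A k ∧ d ∈ A j) := by
  have small : ∀ x, x = i ∨ x = j ∨ x = k → (B x).card ≤ 1 → (A x ∪ B x).card ≤ 2 := by
    intro x hx h
    have := Finset.card_union_le (A x) (B x)
    have := hA x hx
    by_cases hb : B x = ∅
    · simpa [hb] using this
    · have := hB x hx hb
      omega
  have zero : ∀ x, B x = ∅ → (B x).card ≤ 1 := fun x h => by simp [h]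
  have large : ∀ x, x = i ∨ x = j ∨ x = k → 2 ≤ (B x).card →
      (A x ∪ B x).card ≤ 3 ∧ (A x).card ≤ 1 := by
    intro x hx h
    have := Finset.card_union_le (A x) (B x)
    have := hcard x hx
    have := hB x hx (by rintro h0; simp [h0] at h)
    omega
  by_cases hi : 2 ≤ (B i).card
  · obtain ⟨a, ha, b, hb, d, hd, h⟩ := exists_three_colors_of_card_le_three hM
      (large i (by simp) hi).1 Finset.subset_union_left (large i (by simp) hi).2
      (small j (by simp) (zero j (hij hi))) (small k (by simp) (zero k (hik hi)))
    exact ⟨a, ha, b, hb, d, hd, by grind⟩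
  by_cases hj : 2 ≤ (B j).card
  · obtain ⟨b, hb, a, ha, d, hd, h⟩ := exists_three_colors_of_card_le_three hM
      (large j (by simp) hj).1 Finset.subset_union_left (large j (by simp) hj).2
      (small i (by simp) (zero i (hji hj))) (small k (by simp) (zero k (hjk hj)))
    exact ⟨a, ha, b, hb, d, hd, by grind⟩
  by_cases hk : 2 ≤ (B k).card
  · obtain ⟨d, hd, a, ha, b, hb, h⟩ := exists_three_colors_of_card_le_three hM
      (large k (by simp) hk).1 Finset.subset_union_left (large k (by simp) hk).2
      (small i (by simp) (zero i (hki hk))) (small j (by simp) (zero j (hkj hk)))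
    exact ⟨a, ha, b, hb, d, hd, by grind⟩
  obtain ⟨a, ha, b, hb, d, hd, h⟩ := exists_three_colors hM (small i (by simp) (by omega))
    (small j (by simp) (by omega)) (small k (by simp) (by omega))
  exact ⟨a, ha, b, hb, d, hd, by grind⟩

/-- The color choice around a vertex of degree five: `A x` is the set of colors seen by the
neighbor `x ∈ S`, `D` the set of colors seen by the fifth neighbor, `r` the color of the edge to
the fifth neighbor, and `Bad r s x` says that giving color `s` to the edge to `x` closes a
bichromatic cycle through the fifth neighbor. -/
theorem exists_colors_around [Fintype α] {ι : Type*} [DecidableEq ι] {S : Finset ι}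
    (hS : S.card = 4) {A : ι → Finset α} (hA : ∀ x ∈ S, (A x).card ≤ 2) {D : Finset α}
    (hD : D.card + 3 ≤ Fintype.card α) (hα : 7 ≤ Fintype.card α) {Bad : α → α → ι → Prop}
    (hBad : ∀ r s x, Bad r s x → s ∈ D ∧ r ∈ A x)
    (huniq : ∀ r s, r ∉ D → ∀ x ∈ S, ∀ y ∈ S, Bad r s x → Bad r s y → x = y) :
    ∃ r ∉ D, ∃ f : ι → α, Set.InjOn f S ∧ ∀ x ∈ S, f x ≠ r ∧ f x ∉ A x ∧ ¬ Bad r (f x) x ∧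
      ∀ y ∈ S, x ≠ y → ¬ (f x ∈ A y ∧ f y ∈ A x) := by
  classical
  obtain ⟨E, hED, hE⟩ : ∃ E ⊆ Dᶜ, E.card = 3 :=
    Finset.exists_subset_card_eq (by rw [Finset.card_compl]; omega)
  obtain ⟨K, hEK, hK⟩ : ∃ K : Finset α, E ⊆ K ∧ K.card = 7 := by
    obtain ⟨K, h1, -, h2⟩ := Finset.exists_subsuperset_card_eq (Finset.subset_univ E)
      (n := 7) (by omega) (by simpa using hα)
    exact ⟨K, h1, h2⟩
  have hKD : (K ∩ D).card ≤ 4 := by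
    have hsub : K ∩ D ⊆ K \ E := by
      intro x hx
      have := @hED x
      simp only [Finset.mem_compl] at this
      grind
    have := Finset.card_le_card hsub
    rw [Finset.card_sdiff_of_subset hEK] at this
    omega
  by_cases hr : ∃ r ∈ E, ∃ x ∈ S, r ∈ A x
  · obtain ⟨r, hrE, hrx⟩ := hr
    have hrD : r ∉ D := by simpa using hED hrE
    set B : ι → Finset α := fun x => {s ∈ K | Bad r s x} with hBdef
    have hsum : ∑ x ∈ S, (B x).card ≤ 4 := by
      rw [← Finset.card_biUnion]
      · refine (Finset.card_le_card ?_).trans hKD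
        intro s hs
        simp only [Finset.mem_biUnion, hBdef, Finset.mem_filter] at hs
        obtain ⟨x, -, hsK, hsx⟩ := hs
        exact Finset.mem_inter.2 ⟨hsK, (hBad _ _ _ hsx).1⟩
      · intro x hx y hy hxy
        rw [Function.onFun, Finset.disjoint_left]
        intro s hsx hsy
        exact hxy (huniq r s hrD x hx y hy (Finset.mem_filter.1 hsx).2 (Finset.mem_filter.1 hsy).2)
    have hBr : ∀ x, r ∉ A x → B x = ∅ := by
      intro x hx
      refine Finset.filter_eq_empty_iff.2 fun s _ h => hx (hBad _ _ _ h).2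
    obtain ⟨i, hi, hmax⟩ := Finset.exists_max_image {x ∈ S | r ∈ A x} (fun x => (B x).card)
      (by obtain ⟨x, hx, hxr⟩ := hrx; exact ⟨x, by simp [hx, hxr]⟩)
    obtain ⟨hiS, hri⟩ := Finset.mem_filter.1 hi
    have hmax' : ∀ x ∈ S, (B x).card ≤ (B i).card := by
      intro x hx
      by_cases hxr : r ∈ A x
      · exact hmax x (by simp [hx, hxr])
      · simp [hBr x hxr]
    obtain ⟨j₁, j₂, j₃, h12, h13, h23, hj⟩ := Finset.card_eq_three.1
      (show (S.erase i).card = 3 by rw [Finset.card_erase_of_mem hiS]; omega)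
    have hmem : ∀ x, x ∈ S ↔ x = i ∨ x = j₁ ∨ x = j₂ ∨ x = j₃ := by
      intro x
      have : x ∈ S.erase i ↔ x ∈ ({j₁, j₂, j₃} : Finset ι) := by rw [hj]
      simp only [Finset.mem_erase, Finset.mem_insert, Finset.mem_singleton] at this
      grind
    have hji : ∀ x, x = j₁ ∨ x = j₂ ∨ x = j₃ → x ≠ i ∧ x ∈ S := by
      intro x hx
      have : x ∈ S.erase i := by rw [hj]; simpa using hx
      simpa using this
    rw [← Finset.add_sum_erase S _ hiS, hj, Finset.sum_insert (by simp [h12, h13]),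
      Finset.sum_insert (by simp [h23]), Finset.sum_singleton] at hsum
    obtain ⟨p, hpK, hp⟩ : ∃ p ∈ K, p ∉ A i ∪ B i := by
      refine Finset.exists_mem_notMem_of_card_le_of_lt (m := 6) hK.ge ?_ (by norm_num)
      have := Finset.card_union_le (A i) (B i)
      have := hA i hiS
      omega
    simp only [Finset.mem_union, not_or] at hp
    have hpr : p ≠ r := fun h => hp.1 (h ▸ hri)
    set A' : ι → Finset α := fun x =>
      (if p ∈ A x then (A x).erase p ∪ (A i).erase r else A x).erase r with hA'def
    have hAi : ((A i).erase r).card ≤ 1 := by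
      rw [Finset.card_erase_of_mem hri]
      have := hA i hiS
      omega
    have hA' : ∀ x ∈ S, (A' x).card ≤ 2 := by
      intro x hx
      have := hA x hx
      refine (Finset.card_erase_le).trans ?_
      split_ifs with h
      · refine (Finset.card_union_le _ _).trans ?_
        rw [Finset.card_erase_of_mem h]
        omega
      · exact this
    have hA'r : ∀ x ∈ S, r ∈ A x → (A' x).card ≤ 1 := by
      intro x hx hxr
      have := hA x hx
      by_cases h : p ∈ A x
      · have hsub : A' x ⊆ ((A x).erase p).erase r ∪ (A i).erase r := by
          intro y hy
          simp only [hA'def, h, if_true] at hy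
          grind
        refine (Finset.card_le_card hsub).trans ((Finset.card_union_le _ _).trans ?_)
        rw [Finset.card_erase_of_mem (Finset.mem_erase.2 ⟨hpr.symm, hxr⟩),
          Finset.card_erase_of_mem h]
        omega
      · simp only [hA'def, h, if_false]
        rw [Finset.card_erase_of_mem hxr]
        omega
    have hM : 5 ≤ ((K.erase r).erase p).card := by
      have := Finset.pred_card_le_card_erase (s := K) (a := r)
      have := Finset.pred_card_le_card_erase (s := K.erase r) (a := p)
      omega
    have m1 := hmax' j₁ (hji j₁ (by simp)).2
    have m2 := hmax' j₂ (hji j₂ (by simp)).2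
    have m3 := hmax' j₃ (hji j₃ (by simp)).2
    obtain ⟨a, ha, b, hb, d, hd, hab, had, hbd, ha', hb', hd', hm1, hm2, hm3⟩ :=
      exists_three_colors_of_forbidden (A := A') (B := B) (i := j₁) (j := j₂) (k := j₃) hM
        (fun x hx => hA' x (hji x hx).2)
        (fun x hx hne => hA'r x (hji x hx).2 (by by_contra h; exact hne (hBr x h)))
        (by rintro x (rfl | rfl | rfl) <;> omega)
        (fun h => Finset.card_eq_zero.1 (by omega)) (fun h => Finset.card_eq_zero.1 (by omega))
        (fun h => Finset.card_eq_zero.1 (by omega)) (fun h => Finset.card_eq_zero.1 (by omega))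
        (fun h => Finset.card_eq_zero.1 (by omega)) (fun h => Finset.card_eq_zero.1 (by omega))
    have hkey : ∀ x c, c ≠ r → c ≠ p → c ∉ A' x → c ∉ A x ∧ ¬ (p ∈ A x ∧ c ∈ A i) := by
      intro x c hcr hcp hc
      simp only [hA'def] at hc
      split_ifs at hc <;> grind
    have hsub : ∀ x c, c ≠ r → c ≠ p → c ∈ A x → c ∈ A' x := by
      intro x c hcr hcp hc
      simp only [hA'def]
      split_ifs <;> grind
    have hBK : ∀ x c, c ∈ K → c ∉ B x → ¬ Bad r c x := by
      intro x c hc hcB h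
      exact hcB (Finset.mem_filter.2 ⟨hc, h⟩)
    simp only [Finset.mem_erase, Finset.mem_union, not_or] at ha hb hd ha' hb' hd'
    have ka := hkey j₁ a ha.2.1 ha.1 ha'.1
    have kb := hkey j₂ b hb.2.1 hb.1 hb'.1
    have kd := hkey j₃ d hd.2.1 hd.1 hd'.1
    have n1 := (hji j₁ (by simp)).1
    have n2 := (hji j₂ (by simp)).1
    have n3 := (hji j₃ (by simp)).1
    have q12 : ¬ (a ∈ A j₂ ∧ b ∈ A j₁) := fun h =>
      hm1 ⟨hsub _ _ ha.2.1 ha.1 h.1, hsub _ _ hb.2.1 hb.1 h.2⟩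
    have q13 : ¬ (a ∈ A j₃ ∧ d ∈ A j₁) := fun h =>
      hm2 ⟨hsub _ _ ha.2.1 ha.1 h.1, hsub _ _ hd.2.1 hd.1 h.2⟩
    have q23 : ¬ (b ∈ A j₃ ∧ d ∈ A j₂) := fun h =>
      hm3 ⟨hsub _ _ hb.2.1 hb.1 h.1, hsub _ _ hd.2.1 hd.1 h.2⟩
    have r0 := hBK i p hpK hp.2
    have r1 := hBK j₁ a ha.2.2 ha'.2
    have r2 := hBK j₂ b hb.2.2 hb'.2
    have r3 := hBK j₃ d hd.2.2 hd'.2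
    obtain ⟨f, f0, f1, f2, f3⟩ : ∃ f : ι → α, f i = p ∧ f j₁ = a ∧ f j₂ = b ∧ f j₃ = d :=
      ⟨fun x => if x = i then p else if x = j₁ then a else if x = j₂ then b else d,
        by simp, by simp [n1], by simp [n2, h12.symm], by simp [n3, h13.symm, h23.symm]⟩
    refine ⟨r, hrD, f, ?_, ?_⟩
    · intro x hx y hy hxy
      rw [Finset.mem_coe, hmem] at hx hy
      rcases hx with rfl | rfl | rfl | rfl <;> rcases hy with rfl | rfl | rfl | rfl <;> grind
    · intro x hx
      refine ⟨?_, ?_, ?_, ?_⟩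
      · rw [hmem] at hx
        rcases hx with rfl | rfl | rfl | rfl <;> grind
      · rw [hmem] at hx
        rcases hx with rfl | rfl | rfl | rfl <;> grind
      · rw [hmem] at hx
        rcases hx with rfl | rfl | rfl | rfl <;> simpa only [f0, f1, f2, f3]
      · intro y hy hxy
        rw [hmem] at hx hy
        rcases hx with rfl | rfl | rfl | rfl <;> rcases hy with rfl | rfl | rfl | rfl <;> grind
  · push Not at hr
    obtain ⟨r, p, q, hrp, -, -, rfl⟩ := Finset.card_eq_three.1 hE
    have hrD : r ∉ D := by simpa using hED (show r ∈ _ by simp)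
    have hrA := hr r (by simp)
    have hpA := hr p (by simp)
    obtain ⟨i, hiS⟩ : S.Nonempty := Finset.card_pos.1 (by omega)
    obtain ⟨j₁, j₂, j₃, h12, h13, h23, hj⟩ := Finset.card_eq_three.1
      (show (S.erase i).card = 3 by rw [Finset.card_erase_of_mem hiS]; omega)
    have hmem : ∀ x, x ∈ S ↔ x = i ∨ x = j₁ ∨ x = j₂ ∨ x = j₃ := by
      intro x
      have : x ∈ S.erase i ↔ x ∈ ({j₁, j₂, j₃} : Finset ι) := by rw [hj]
      simp only [Finset.mem_erase, Finset.mem_insert, Finset.mem_singleton] at this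
      grind
    have hji : ∀ x, x = j₁ ∨ x = j₂ ∨ x = j₃ → x ≠ i ∧ x ∈ S := by
      intro x hx
      have : x ∈ S.erase i := by rw [hj]; simpa using hx
      simpa using this
    have hM : 5 ≤ ((K.erase r).erase p).card := by
      have := Finset.pred_card_le_card_erase (s := K) (a := r)
      have := Finset.pred_card_le_card_erase (s := K.erase r) (a := p)
      omega
    obtain ⟨n1, s1⟩ := hji j₁ (by simp)
    obtain ⟨n2, s2⟩ := hji j₂ (by simp)
    obtain ⟨n3, s3⟩ := hji j₃ (by simp)
    obtain ⟨a, ha, b, hb, d, hd, hab, had, hbd, ha', hb', hd', hm1, hm2, hm3⟩ :=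
      exists_three_colors hM (hA j₁ s1) (hA j₂ s2) (hA j₃ s3)
    simp only [Finset.mem_erase] at ha hb hd
    obtain ⟨f, f0, f1, f2, f3⟩ : ∃ f : ι → α, f i = p ∧ f j₁ = a ∧ f j₂ = b ∧ f j₃ = d :=
      ⟨fun x => if x = i then p else if x = j₁ then a else if x = j₂ then b else d,
        by simp, by simp [n1], by simp [n2, h12.symm], by simp [n3, h13.symm, h23.symm]⟩
    refine ⟨r, hrD, f, ?_, ?_⟩
    · intro x hx y hy hxy
      rw [Finset.mem_coe, hmem] at hx hy
      rcases hx with rfl | rfl | rfl | rfl <;> rcases hy with rfl | rfl | rfl | rfl <;> grind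
    · intro x hx
      refine ⟨?_, ?_, fun h => hrA x hx (hBad _ _ _ h).2, ?_⟩
      · rw [hmem] at hx
        rcases hx with rfl | rfl | rfl | rfl <;> grind
      · have := hpA x hx
        rw [hmem] at hx
        rcases hx with rfl | rfl | rfl | rfl <;> grind
      · intro y hy hxy
        have := hpA x hx
        have := hpA y hy
        rw [hmem] at hx hy
        rcases hx with rfl | rfl | rfl | rfl <;> rcases hy with rfl | rfl | rfl | rfl <;> grind

end Choosing

section Extending

variable {V α : Type*}

/-- The subgraph formed by the edges of colors `a` and `b`. -/
def bichromaticSubgraph (G : SimpleGraph V) (c : Sym2 V → α) (a b : α) : SimpleGraph V where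
  Adj x y := G.Adj x y ∧ (c s(x, y) = a ∨ c s(x, y) = b)
  symm := ⟨fun x y h => ⟨h.1.symm, by rw [Sym2.eq_swap]; exact h.2⟩⟩
  loopless := ⟨fun x h => G.loopless.irrefl x h.1⟩

theorem bichromaticSubgraph_comm (G : SimpleGraph V) (c : Sym2 V → α) (a b : α) :
    bichromaticSubgraph G c a b = bichromaticSubgraph G c b a := by
  ext x y
  simp only [bichromaticSubgraph, or_comm]

/-- A nontrivial bichromatic walk leaves its start through one of the two colors. -/
theorem exists_adj_of_reachable_bichromaticSubgraph {G : SimpleGraph V} {c : Sym2 V → α}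
    {a b : α} {x y : V} (h : (bichromaticSubgraph G c a b).Reachable x y) (hxy : x ≠ y)
    (ha : ∀ z, G.Adj x z → c s(x, z) ≠ a) : ∃ z, G.Adj x z ∧ c s(x, z) = b := by
  obtain ⟨w⟩ := h
  cases w with
  | nil => exact absurd rfl hxy
  | cons h _ => exact ⟨_, h.1, h.2.resolve_left (ha _ h.1)⟩

theorem IsProperEdgeColoring.eq_of_color_eq {G : SimpleGraph V} {c : Sym2 V → α}
    (hc : IsProperEdgeColoring G c) {x y z : V} (hy : G.Adj x y) (hz : G.Adj x z)
    (h : c s(x, y) = c s(x, z)) : y = z := by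
  by_contra hne
  exact hc _ hy _ hz (fun h' => hne (Sym2.congr_right.1 h'))
    ⟨x, Sym2.mem_mk_left _ _, Sym2.mem_mk_left _ _⟩ h

/-- In a graph of maximum degree at most two, two paths that start in the same direction and end
in leaves have the same end. -/
theorem eq_of_isPath_of_leaves {H : SimpleGraph V}
    (h2 : ∀ x a b d, H.Adj x a → H.Adj x b → H.Adj x d → a = b ∨ a = d ∨ b = d) {x y : V}
    (p : H.Walk x y) (hp : p.IsPath) {u : V} (hu : H.Adj x u) (hup : u ∉ p.support) {z : V}
    (q : H.Walk x z) (hq : q.IsPath) (huq : u ∉ q.support)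
    (hy : ∀ a b, H.Adj y a → H.Adj y b → a = b) (hz : ∀ a b, H.Adj z a → H.Adj z b → a = b) :
    y = z := by
  induction p generalizing u with
  | nil =>
    cases q with
    | nil => rfl
    | cons h q' =>
      have := hy _ _ hu h
      subst this
      simp at huq
  | @cons x x₁ y h p' ih =>
    cases q with
    | nil =>
      have := hz _ _ hu h
      subst this
      simp at hup
    | @cons _ x₂ _ h' q' =>
      rw [Walk.support_cons, List.mem_cons, not_or] at hup huq
      have e1 : u ≠ x₁ := fun h => hup.2 (h ▸ p'.start_mem_support)
      have e2 : u ≠ x₂ := fun h => huq.2 (h ▸ q'.start_mem_support)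
      have e : x₁ = x₂ := by
        rcases h2 x u x₁ x₂ hu h h' with h | h | h
        · exact absurd h e1
        · exact absurd h e2
        · exact h
      subst e
      rw [Walk.cons_isPath_iff] at hp hq
      exact ih hp.1 h.symm hp.2 q' hq.1 hq.2 hy

theorem eq_of_reachable_of_leaves {H : SimpleGraph V}
    (h2 : ∀ x a b d, H.Adj x a → H.Adj x b → H.Adj x d → a = b ∨ a = d ∨ b = d) {x y z : V}
    (hxy : H.Reachable x y) (hxz : H.Reachable x z) (hx : ∀ a b, H.Adj x a → H.Adj x b → a = b)
    (hy : ∀ a b, H.Adj y a → H.Adj y b → a = b) (hz : ∀ a b, H.Adj z a → H.Adj z b → a = b)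
    (hxy' : x ≠ y) (hxz' : x ≠ z) : y = z := by
  obtain ⟨p, hp⟩ := hxy.exists_isPath
  obtain ⟨q, hq⟩ := hxz.exists_isPath
  cases p with
  | nil => exact absurd rfl hxy'
  | cons h p =>
    cases q with
    | nil => exact absurd rfl hxz'
    | cons h' q =>
      have e := hx _ _ h h'
      subst e
      rw [Walk.cons_isPath_iff] at hp hq
      exact eq_of_isPath_of_leaves h2 p hp.1 h.symm hp.2 q hq.1 hq.2 hy hz

/-- A bichromatic component contains at most one further vertex missing one of the two colors
besides a given one. -/
theorem IsProperEdgeColoring.eq_of_reachable {G : SimpleGraph V} {c : Sym2 V → α}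
    (hc : IsProperEdgeColoring G c) {r s : α} {x y z : V}
    (hxy : (bichromaticSubgraph G c r s).Reachable x y)
    (hxz : (bichromaticSubgraph G c r s).Reachable x z)
    (hx : ∀ a, G.Adj x a → c s(x, a) ≠ r) (hy : ∀ a, G.Adj y a → c s(y, a) ≠ s)
    (hz : ∀ a, G.Adj z a → c s(z, a) ≠ s) (hxy' : x ≠ y) (hxz' : x ≠ z) : y = z := by
  refine eq_of_reachable_of_leaves ?_ hxy hxz ?_ ?_ ?_ hxy' hxz'
  · intro x a b d ha hb hd
    have e := fun {y z} (hy : (bichromaticSubgraph G c r s).Adj x y)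
      (hz : (bichromaticSubgraph G c r s).Adj x z) => hc.eq_of_color_eq hy.1 hz.1
    have e1 := e ha hb
    have e2 := e ha hd
    have e3 := e hb hd
    rcases ha.2 with h | h <;> rcases hb.2 with h' | h' <;> rcases hd.2 with h'' | h'' <;>
      simp_all
  · intro a b ha hb
    exact hc.eq_of_color_eq ha.1 hb.1
      ((ha.2.resolve_left (hx _ ha.1)).trans (hb.2.resolve_left (hx _ hb.1)).symm)
  · intro a b ha hb
    exact hc.eq_of_color_eq ha.1 hb.1
      ((ha.2.resolve_right (hy _ ha.1)).trans (hb.2.resolve_right (hy _ hb.1)).symm)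
  · intro a b ha hb
    exact hc.eq_of_color_eq ha.1 hb.1
      ((ha.2.resolve_right (hz _ ha.1)).trans (hb.2.resolve_right (hz _ hb.1)).symm)

/-- Extending an acyclic edge coloring of `G - v` to `G`. -/
theorem exists_isAcyclicEdgeColoring_extending [DecidableEq V] {G : SimpleGraph V} {v : V}
    {c : Sym2 V → α} (hc : IsAcyclicEdgeColoring (G.deleteIncidenceSet v) c) (f : V → α)
    (hinj : ∀ x y, G.Adj v x → G.Adj v y → x ≠ y → f x ≠ f y)
    (hf : ∀ x y, G.Adj v x → (G.deleteIncidenceSet v).Adj x y → c s(x, y) ≠ f x)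
    (hreach : ∀ x y, G.Adj v x → G.Adj v y → x ≠ y →
      ¬ (bichromaticSubgraph (G.deleteIncidenceSet v) c (f x) (f y)).Reachable x y) :
    ∃ c' : Sym2 V → α, IsAcyclicEdgeColoring G c' := by
  set c' : Sym2 V → α := fun e => if h : v ∈ e then f (Sym2.Mem.other' h) else c e with hc'
  have hv : ∀ x, c' s(v, x) = f x := by
    intro x
    have h : v ∈ s(v, x) := Sym2.mem_mk_left _ _
    have : c' s(v, x) = f (Sym2.Mem.other' h) := by simp only [hc', h, dif_pos]
    rw [this, Sym2.congr_right.1 (Sym2.other_spec' h)]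
  have hne : ∀ e, v ∉ e → c' e = c e := fun e h => by simp only [hc', h, dif_neg, not_false_iff]
  have hadj : ∀ {x y}, G.Adj x y → x ≠ v → y ≠ v → (G.deleteIncidenceSet v).Adj x y :=
    fun h hx hy => deleteIncidenceSet_adj.2 ⟨h, hx, hy⟩
  refine ⟨c', ?_, ?_⟩
  · rintro e₁ h₁ e₂ h₂ hne' ⟨u, hu₁, hu₂⟩
    obtain ⟨x, rfl⟩ := Sym2.mem_iff_exists.1 hu₁
    obtain ⟨y, rfl⟩ := Sym2.mem_iff_exists.1 hu₂
    rw [mem_edgeSet] at h₁ h₂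
    have hxy : x ≠ y := fun h => hne' (h ▸ rfl)
    by_cases hu : u = v
    · subst hu
      rw [hv, hv]
      exact hinj x y h₁ h₂ hxy
    have mixed : ∀ z, G.Adj u v → G.Adj u z → z ≠ v → c' s(u, v) ≠ c' s(u, z) := by
      intro z huv huz hz
      rw [Sym2.eq_swap, hv, hne _ (by simp [Ne.symm hu, hz.symm])]
      exact (hf u z huv.symm (hadj huz hu hz)).symm
    by_cases hx : x = v
    · subst hx
      exact mixed y h₁ h₂ hxy.symm
    by_cases hy : y = v
    · subst hy
      exact (mixed x h₂ h₁ hxy).symm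
    rw [hne _ (by simp [Ne.symm hu, Ne.symm hx]), hne _ (by simp [Ne.symm hu, Ne.symm hy])]
    exact hc.1 _ (hadj h₁ hu hx) _ (hadj h₂ hu hy) hne' ⟨u, hu₁, hu₂⟩
  · rintro u w hw ⟨a, b, hab⟩
    by_cases hvw : v ∈ w.support
    · have hw' := hw.rotate hvw
      have hab' : ∀ e ∈ (w.rotate v hvw).edges, c' e = a ∨ c' e = b :=
        fun e he => hab e ((w.rotate_edges v hvw).mem_iff.1 he)
      generalize w.rotate v hvw = w' at hw' hab'
      cases w' with
      | nil => exact hw'.not_nil Walk.Nil.nil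
      | @cons _ x _ h p =>
        rw [Walk.cons_isCycle_iff] at hw'
        obtain ⟨hp, hvp⟩ := hw'
        rw [← p.reverse_reverse] at hp hvp hab'
        generalize p.reverse = p' at hp hvp hab'
        cases p' with
        | nil => exact h.ne rfl
        | @cons _ y _ h' q =>
          rw [Walk.isPath_reverse_iff, Walk.cons_isPath_iff] at hp
          have hxy : y ≠ x := by
            rintro rfl
            simp at hvp
          simp only [Walk.edges_cons, Walk.edges_reverse, List.mem_cons, List.mem_reverse] at hab'
          have hx := hab' _ (Or.inl rfl)
          have hy := hab' _ (Or.inr (Or.inl rfl))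
          rw [hv] at hx hy
          have hfxy := hinj y x h' h hxy
          refine hreach y x h' h hxy ⟨q.transfer _ ?_⟩
          intro e he
          have hcol := hab' e (Or.inr (Or.inr he))
          induction e using Sym2.ind with
          | _ s t =>
            have hs : s ≠ v := fun e => hp.2 (e ▸ q.fst_mem_support_of_mem_edges he)
            have ht : t ≠ v := fun e => hp.2 (e ▸ q.snd_mem_support_of_mem_edges he)
            rw [hne _ (by simp [hs.symm, ht.symm])] at hcol
            refine ⟨hadj (q.adj_of_mem_edges he) hs ht, ?_⟩
            grind
    · have hmem : ∀ e ∈ w.edges, v ∉ e := fun e he hve =>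
        hvw (w.mem_support_of_mem_edges he hve)
      have htr : ∀ e ∈ w.edges, e ∈ (G.deleteIncidenceSet v).edgeSet := by
        intro e he
        have hve := hmem e he
        have hG := w.edges_subset_edgeSet he
        induction e using Sym2.ind with
        | _ s t =>
          simp only [Sym2.mem_iff, not_or] at hve
          exact hadj hG (Ne.symm hve.1) (Ne.symm hve.2)
      refine hc.2 u (w.transfer _ htr) (hw.transfer htr) ⟨a, b, fun e he => ?_⟩
      rw [Walk.edges_transfer] at he
      rw [← hne e (hmem e he)]
      exact hab e he

end Extending

theorem stmt16 {V : Type*} [Fintype V] [DecidableEq V] (G : SimpleGraph V) [DecidableRel G.Adj]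
    (hG : IsAcyclicallyEdgeCritical G (G.maxDegree + 2))
    (v : V) (hv : G.degree v = 5) :
    ((G.neighborFinset v).filter fun w => G.degree w = 2).card +
      ((G.neighborFinset v).filter fun w => G.degree w = 3).card ≤ 3 := by
  classical
  by_contra! hcon
  have hΔ := G.degree_le_maxDegree v
  rw [← Finset.card_union_of_disjoint
    (Finset.disjoint_filter.2 fun x _ h => by omega)] at hcon
  obtain ⟨S, hSsub, hS⟩ := Finset.exists_subset_card_eq (Nat.succ_le_of_lt hcon)
  have hSN : ∀ x ∈ S, G.Adj v x ∧ G.degree x ≤ 3 := by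
    intro x hx
    have := hSsub hx
    simp only [Finset.mem_union, Finset.mem_filter, mem_neighborFinset] at this
    rcases this with h | h <;> exact ⟨h.1, by omega⟩
  have hSN' : S ⊆ G.neighborFinset v := fun x hx => by simpa using (hSN x hx).1
  obtain ⟨u, hu⟩ := Finset.card_eq_one.1
    (show (G.neighborFinset v \ S).card = 1 by
      rw [Finset.card_sdiff_of_subset hSN', card_neighborFinset_eq_degree]; omega)
  have hu' : G.Adj v u ∧ u ∉ S := by
    have : u ∈ G.neighborFinset v \ S := by simp [hu]
    simpa using this
  have hN : ∀ x, G.Adj v x → x = u ∨ x ∈ S := by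
    intro x hx
    by_contra! h
    have : x ∈ G.neighborFinset v \ S := by simp [hx, h.2]
    rw [hu, Finset.mem_singleton] at this
    exact h.1 this
  set H := G.deleteIncidenceSet v with hH
  have hHadj : ∀ {x y}, H.Adj x y ↔ G.Adj x y ∧ x ≠ v ∧ y ≠ v := deleteIncidenceSet_adj
  obtain ⟨c, hc⟩ := hG.2 H (lt_of_le_of_ne (fun x y h => (hHadj.1 h).1) (fun h => by
    have := hu'.1
    rw [← h, hHadj] at this
    exact this.2.1 rfl))
  set A : V → Finset (Fin (G.maxDegree + 2)) :=
    fun x => ((G.neighborFinset x).erase v).image fun y => c s(x, y) with hAdef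
  have hA : ∀ x, G.Adj v x → (A x).card ≤ G.degree x - 1 := by
    intro x hx
    refine Finset.card_image_le.trans_eq ?_
    rw [Finset.card_erase_of_mem (by simpa using hx.symm), card_neighborFinset_eq_degree]
  have hmemA : ∀ {x s}, G.Adj v x → (s ∈ A x ↔ ∃ y, H.Adj x y ∧ c s(x, y) = s) := by
    intro x s hx
    simp only [hAdef, Finset.mem_image, Finset.mem_erase, mem_neighborFinset, hHadj]
    have := hx.ne'
    grind
  have hnotMem : ∀ {x s}, G.Adj v x → s ∉ A x → ∀ y, H.Adj x y → c s(x, y) ≠ s :=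
    fun hx hs y hy h => hs ((hmemA hx).2 ⟨y, hy, h⟩)
  have hmem : ∀ {x y a b}, G.Adj v x → x ≠ y →
      (bichromaticSubgraph H c a b).Reachable x y → a ∉ A x → b ∈ A x :=
    fun hx hxy h ha =>
      (hmemA hx).2 (exists_adj_of_reachable_bichromaticSubgraph h hxy (hnotMem hx ha))
  obtain ⟨r, hrD, f, hfinj, hf⟩ := exists_colors_around hS
    (A := A) (fun x hx => (hA x (hSN x hx).1).trans (by have := (hSN x hx).2; omega))
    (D := A u)
    (by
      have := hA u hu'.1
      have := G.degree_le_maxDegree u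
      rw [Fintype.card_fin]
      omega)
    (by rw [Fintype.card_fin]; omega)
    (Bad := fun r s x => (s ∈ A u ∧ r ∈ A x) ∧ s ∉ A x ∧
      (bichromaticSubgraph H c r s).Reachable u x)
    (fun r s x h => h.1)
    (fun r s hr x hx y hy h h' => hc.1.eq_of_reachable h.2.2 h'.2.2 (hnotMem hu'.1 hr)
      (hnotMem (hSN x hx).1 h.2.1) (hnotMem (hSN y hy).1 h'.2.1)
      (fun e => hu'.2 (e ▸ hx)) (fun e => hu'.2 (e ▸ hy)))
  have hg : ∀ x ∈ S, (if x = u then r else f x) = f x :=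
    fun x hx => if_neg fun e : x = u => hu'.2 (e ▸ hx)
  have hur : ∀ x ∈ S, ¬ (bichromaticSubgraph H c r (f x)).Reachable u x := by
    intro x hx h
    have hxu : u ≠ x := fun e => hu'.2 (e ▸ hx)
    obtain ⟨-, hfx, hbad, -⟩ := hf x hx
    refine hbad ⟨⟨hmem hu'.1 hxu h hrD, ?_⟩, hfx, h⟩
    rw [bichromaticSubgraph_comm] at h
    exact hmem (hSN x hx).1 hxu.symm h.symm hfx
  refine hG.1 (exists_isAcyclicEdgeColoring_extending hc (fun x => if x = u then r else f x)
    ?_ ?_ ?_)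
  · intro x y hx hy hxy
    rcases hN x hx with rfl | hxS <;> rcases hN y hy with rfl | hyS
    · exact absurd rfl hxy
    · simpa only [if_true, hg y hyS] using (hf y hyS).1.symm
    · simpa only [if_true, hg x hxS] using (hf x hxS).1
    · simpa only [hg x hxS, hg y hyS] using fun e : f x = f y => hxy (hfinj hxS hyS e)
  · intro x y hx hxy
    rcases hN x hx with rfl | hxS
    · simpa only [if_true] using hnotMem hx hrD y hxy
    · simpa only [hg x hxS] using hnotMem hx (hf x hxS).2.1 y hxy
  · intro x y hx hy hxy
    rcases hN x hx with rfl | hxS <;> rcases hN y hy with rfl | hyS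
    · exact absurd rfl hxy
    · simpa only [if_true, hg y hyS] using hur y hyS
    · simp only [if_true, hg x hxS]
      rw [bichromaticSubgraph_comm]
      exact fun h => hur x hxS h.symm
    · simp only [hg x hxS, hg y hyS]
      intro h
      refine (hf x hxS).2.2.2 y hyS hxy ⟨?_, hmem hx hxy h (hf x hxS).2.1⟩
      rw [bichromaticSubgraph_comm] at h
      exact hmem hy hxy.symm h.symm (hf y hyS).2.1
end

section
/- Let G be a connected finite simple graph with n vertices and m edges such that m ≤ 2n − 1 and maximum degree Δ(G) ≤ 4. Then the acyclic chromatic index of G satisfies χ'_a(G) ≤ 6. -/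
open SimpleGraph

namespace PartialEdgeColoring

variable {V : Type*}

/-- Vertex `v` is incident to an edge of color `k`. -/
def Sees (c : Sym2 V → Option (Fin 6)) (v : V) (k : Fin 6) : Prop :=
  ∃ w, c s(v, w) = some k

/-- The graph formed by the edges of color `i` or `j`. -/
def twoColor (c : Sym2 V → Option (Fin 6)) (i j : Fin 6) : SimpleGraph V where
  Adj u v := u ≠ v ∧ (c s(u, v) = some i ∨ c s(u, v) = some j)
  symm := ⟨fun u v h => by rwa [Sym2.eq_swap, ne_comm]⟩
  loopless := ⟨fun _ h => h.1 rfl⟩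

/-- A path with colors `i` and `j` joins `u` to `v`. -/
def Linked (c : Sym2 V → Option (Fin 6)) (i j : Fin 6) (u v : V) : Prop :=
  (twoColor c i j).Reachable u v

/-- A partial edge coloring that is proper and has no cycle with at most two colors. -/
structure Acyc (c : Sym2 V → Option (Fin 6)) : Prop where
  diag : ∀ v, c s(v, v) = none
  proper : ∀ {v u w k}, c s(v, u) = some k → c s(v, w) = some k → u = w
  acyclic : ∀ i j, (twoColor c i j).IsAcyclic

/-- At most `n` colors are seen at `v`. -/
def SeesAtMost (c : Sym2 V → Option (Fin 6)) (v : V) (n : ℕ) : Prop :=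
  ∀ l : List (Fin 6), l.Nodup → (∀ k ∈ l, Sees c v k) → l.length ≤ n

variable {c c' : Sym2 V → Option (Fin 6)} {i j k l m : Fin 6} {a b u v w x y : V}

lemma Sees.of_right (h : c s(u, v) = some k) : Sees c v k := ⟨u, by rwa [Sym2.eq_swap]⟩

lemma twoColor_comm (c : Sym2 V → Option (Fin 6)) (i j : Fin 6) :
    twoColor c i j = twoColor c j i := by
  ext u v; simp [twoColor, or_comm]

lemma Linked.comm (h : Linked c i j u v) : Linked c j i u v := by
  rwa [Linked, twoColor_comm]

lemma Linked.symm (h : Linked c i j u v) : Linked c i j v u := Reachable.symm h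

lemma Linked.trans (h : Linked c i j u v) (h' : Linked c i j v w) : Linked c i j u w :=
  Reachable.trans h h'

lemma twoColor_mono (hc : ∀ e, c e = some i ∨ c e = some j → c' e = some k ∨ c' e = some l) :
    twoColor c i j ≤ twoColor c' k l :=
  fun _ _ h => ⟨h.1, hc _ h.2⟩

lemma Linked.mono (hc : ∀ e, c e = some i ∨ c e = some j → c' e = some i ∨ c' e = some j)
    (h : Linked c i j u v) : Linked c' i j u v :=
  Reachable.mono (twoColor_mono hc) h

/-- A set closed under two-colored adjacency contains everything linked to its members. -/
lemma Linked.mem_of_closed {S : Set V} (h : Linked c i j u v) (hu : u ∈ S)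
    (hS : ∀ s ∈ S, ∀ t, c s(s, t) = some i ∨ c s(s, t) = some j → t ∈ S) : v ∈ S := by
  obtain ⟨p⟩ := h
  induction p with
  | nil => exact hu
  | cons hadj p ih => exact ih (hS _ hu _ hadj.2)

lemma Linked.eq_of_not_sees (h : Linked c i j u v) (hi : ¬ Sees c u i) (hj : ¬ Sees c u j) :
    u = v :=
  (h.mem_of_closed (S := {u}) rfl (by
    rintro s rfl t (ht | ht)
    · exact (hi ⟨t, ht⟩).elim
    · exact (hj ⟨t, ht⟩).elim)).symm

lemma Linked.sees_left (h : Linked c i j u v) (hi : ¬ Sees c u i) (huv : u ≠ v) : Sees c u j := by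
  by_contra hj
  exact huv (h.eq_of_not_sees hi hj)

lemma Linked.sees_right (h : Linked c i j u v) (hj : ¬ Sees c v j) (huv : u ≠ v) : Sees c v i :=
  h.symm.comm.sees_left hj huv.symm

/-- The second vertex of a two-colored path continues with the other color. -/
lemma Linked.sees_next (h : Linked c i j a w) (hc : Acyc c) (hi : ¬ Sees c a i)
    (hu : c s(a, u) = some j) (haw : a ≠ w) (huw : u ≠ w) : Sees c u i := by
  by_contra hui
  have := h.mem_of_closed (S := {a, u}) (by simp) (by
    rintro s (rfl | rfl) t (ht | ht)
    · exact (hi ⟨t, ht⟩).elim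
    · right; exact hc.proper ht hu
    · exact (hui ⟨t, ht⟩).elim
    · left
      rw [Sym2.eq_swap] at hu
      exact hc.proper ht hu)
  rcases this with rfl | rfl
  · exact haw rfl
  · exact huw rfl

/-- In a graph of maximum degree two, two paths that start together and end in vertices of
degree at most one have the same end. -/
lemma eq_of_isPath_of_isPath {H : SimpleGraph V}
    (h2 : ∀ {v a b d}, H.Adj v a → H.Adj v b → H.Adj v d → a = b ∨ a = d ∨ b = d)
    {u v : V} (p : H.Walk u v) : ∀ {t w : V} (q : H.Walk u w), p.IsPath → q.IsPath → H.Adj t u →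
    t ∉ p.support → t ∉ q.support → (∀ a b, H.Adj v a → H.Adj v b → a = b) →
    (∀ a b, H.Adj w a → H.Adj w b → a = b) → v = w := by
  induction p with
  | nil =>
    intro t w q _ _ ht _ htq hv _
    cases q with
    | nil => rfl
    | cons h' q' =>
      have := hv _ _ ht.symm h'
      subst this
      simp at htq
  | cons h p ih =>
    intro t w q hp hq ht htp htq hv hw
    cases q with
    | nil =>
      have := hw _ _ ht.symm h
      subst this
      simp at htp
    | cons h' q' =>
      rw [Walk.cons_isPath_iff] at hp hq
      rw [Walk.support_cons, List.mem_cons, not_or] at htp htq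
      rcases h2 ht.symm h h' with rfl | rfl | rfl
      · exact (htp.2 p.start_mem_support).elim
      · exact (htq.2 q'.start_mem_support).elim
      · exact ih q' hp.1 hq.1 h hp.2 hq.2 hv hw

lemma Acyc.adj_unique (hc : Acyc c) (hv : ¬ Sees c v i ∨ ¬ Sees c v j) (a b : V)
    (ha : (twoColor c i j).Adj v a) (hb : (twoColor c i j).Adj v b) : a = b := by
  rcases hv with hv | hv
  · exact hc.proper (ha.2.resolve_left fun h => hv ⟨_, h⟩) (hb.2.resolve_left fun h => hv ⟨_, h⟩)
  · exact hc.proper (ha.2.resolve_right fun h => hv ⟨_, h⟩) (hb.2.resolve_right fun h => hv ⟨_, h⟩)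

/-- A maximal two-colored path has at most two ends. -/
lemma Linked.false_of_three_ends (h : Linked c i j u v) (h' : Linked c i j u w) (hc : Acyc c)
    (hu : ¬ Sees c u i ∨ ¬ Sees c u j) (hv : ¬ Sees c v i ∨ ¬ Sees c v j)
    (hw : ¬ Sees c w i ∨ ¬ Sees c w j) (huv : u ≠ v) (huw : u ≠ w) (hvw : v ≠ w) : False := by
  classical
  obtain ⟨p, hp⟩ := Reachable.exists_isPath h
  obtain ⟨q, hq⟩ := Reachable.exists_isPath h'
  have h2 : ∀ {v a b d}, (twoColor c i j).Adj v a → (twoColor c i j).Adj v b →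
      (twoColor c i j).Adj v d → a = b ∨ a = d ∨ b = d := by
    rintro v a b d ⟨-, ha⟩ ⟨-, hb⟩ ⟨-, hd⟩
    rcases ha with ha | ha <;> rcases hb with hb | hb <;> rcases hd with hd | hd <;>
      first
        | exact Or.inl (hc.proper ha hb)
        | exact Or.inr (Or.inl (hc.proper ha hd))
        | exact Or.inr (Or.inr (hc.proper hb hd))
  cases p with
  | nil => exact huv rfl
  | cons hp1 p =>
    cases q with
    | nil => exact huw rfl
    | cons hq1 q =>
      obtain rfl := hc.adj_unique hu _ _ hp1 hq1
      rw [Walk.cons_isPath_iff] at hp hq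
      exact hvw (eq_of_isPath_of_isPath h2 p q hp.1 hq.1 hp1 hp.2 hq.2
        (hc.adj_unique hv) (hc.adj_unique hw))

/-! ### Removing and inserting colored edges -/

lemma Acyc.mono (hc : Acyc c) (h : ∀ e k, c' e = some k → c e = some k) : Acyc c' where
  diag v := by
    by_contra hv
    obtain ⟨k, hk⟩ := Option.ne_none_iff_exists'.1 hv
    have := h _ _ hk
    rw [hc.diag] at this
    cases this
  proper h1 h2 := hc.proper (h _ _ h1) (h _ _ h2)
  acyclic i j := (hc.acyclic i j).anti (twoColor_mono fun _ he => he.imp (h _ _) (h _ _))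

variable [DecidableEq V]

lemma sees_update (hn : c s(u, v) = none) :
    Sees (Function.update c s(u, v) (some k)) w m ↔
      Sees c w m ∨ (m = k ∧ (w = u ∨ w = v)) := by
  constructor
  · rintro ⟨t, ht⟩
    by_cases he : s(w, t) = s(u, v)
    · rw [he, Function.update_self] at ht
      right
      refine ⟨(Option.some.inj ht).symm, ?_⟩
      rcases Sym2.eq_iff.1 he with h | h
      · exact Or.inl h.1
      · exact Or.inr h.1
    · rw [Function.update_of_ne he] at ht
      exact Or.inl ⟨t, ht⟩
  · rintro (⟨t, ht⟩ | ⟨rfl, rfl | rfl⟩)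
    · refine ⟨t, ?_⟩
      rw [Function.update_of_ne]
      · exact ht
      · intro he
        rw [he, hn] at ht
        cases ht
    · exact ⟨v, by simp⟩
    · exact ⟨u, by rw [Sym2.eq_swap]; simp⟩

lemma Linked.of_update_of_ne (h : Linked (Function.update c s(u, v) (some k)) i j x y)
    (hi : i ≠ k) (hj : j ≠ k) : Linked c i j x y := by
  refine h.mono fun e he => ?_
  by_cases hee : e = s(u, v)
  · subst hee
    simp only [Function.update_self, Option.some.injEq] at he
    grind
  · rwa [Function.update_of_ne hee] at he

/-- A two-colored path either avoids a newly colored edge or crosses it in one direction. -/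
lemma Linked.of_update (h : Linked (Function.update c s(u, v) (some k)) i j x y) :
    Linked c i j x y ∨ (Linked c i j x u ∧ Linked c i j v y) ∨
      (Linked c i j x v ∧ Linked c i j u y) := by
  obtain ⟨p⟩ := h
  induction p with
  | nil => exact Or.inl (Reachable.refl _)
  | @cons r s t hadj p ih =>
    by_cases he : s(r, s) = s(u, v)
    · rcases Sym2.eq_iff.1 he with ⟨rfl, rfl⟩ | ⟨rfl, rfl⟩
      · rcases ih with ih | ih | ih
        · exact Or.inr (Or.inl ⟨Reachable.refl _, ih⟩)
        · exact Or.inr (Or.inl ⟨Reachable.refl _, ih.2⟩)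
        · exact Or.inl ih.2
      · rcases ih with ih | ih | ih
        · exact Or.inr (Or.inr ⟨Reachable.refl _, ih⟩)
        · exact Or.inl ih.2
        · exact Or.inr (Or.inr ⟨Reachable.refl _, ih.2⟩)
    · have hrs : Linked c i j r s := by
        refine Adj.reachable ⟨hadj.1, ?_⟩
        have := hadj.2
        rwa [Function.update_of_ne he] at this
      rcases ih with ih | ih | ih
      · exact Or.inl (hrs.trans ih)
      · exact Or.inr (Or.inl ⟨hrs.trans ih.1, ih.2⟩)
      · exact Or.inr (Or.inr ⟨hrs.trans ih.1, ih.2⟩)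

/-- Criterion for coloring one further edge. -/
lemma Acyc.update (hc : Acyc c) (huv : u ≠ v) (hn : c s(u, v) = none) (hu : ¬ Sees c u k)
    (hv : ¬ Sees c v k) (hl : ∀ l, l ≠ k → ¬ Linked c l k u v) :
    Acyc (Function.update c s(u, v) (some k)) where
  diag w := by
    rw [Function.update_of_ne, hc.diag]
    intro h
    rcases Sym2.eq_iff.1 h with ⟨rfl, rfl⟩ | ⟨rfl, rfl⟩ <;> exact huv rfl
  proper := by
    intro w s t m hs ht
    by_cases h1 : s(w, s) = s(u, v) <;> by_cases h2 : s(w, t) = s(u, v)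
    · have := h1.trans h2.symm
      grind
    · rw [h1, Function.update_self] at hs
      rw [Function.update_of_ne h2] at ht
      obtain rfl := Option.some.inj hs
      rcases Sym2.eq_iff.1 h1 with ⟨rfl, rfl⟩ | ⟨rfl, rfl⟩
      · exact (hu ⟨_, ht⟩).elim
      · exact (hv ⟨_, ht⟩).elim
    · rw [h2, Function.update_self] at ht
      rw [Function.update_of_ne h1] at hs
      obtain rfl := Option.some.inj ht
      rcases Sym2.eq_iff.1 h2 with ⟨rfl, rfl⟩ | ⟨rfl, rfl⟩
      · exact (hu ⟨_, hs⟩).elim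
      · exact (hv ⟨_, hs⟩).elim
    · rw [Function.update_of_ne h1] at hs
      rw [Function.update_of_ne h2] at ht
      exact hc.proper hs ht
  acyclic := by
    have hl' : ∀ l, ¬ Linked c l k u v := by
      intro l h
      by_cases hlk : l = k
      · subst hlk
        exact huv (h.eq_of_not_sees hu hu)
      · exact hl l hlk h
    have key : ∀ l, (twoColor (Function.update c s(u, v) (some k)) l k).IsAcyclic := by
      intro l
      refine ((hc.acyclic l k).sup_edge_of_not_reachable (hl' l)).anti fun s t h => ?_
      by_cases he : s(s, t) = s(u, v)
      · right
        rw [edge_adj]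
        exact ⟨Sym2.eq_iff.1 he, h.1⟩
      · left
        have := h.2
        rw [Function.update_of_ne he] at this
        exact ⟨h.1, this⟩
    intro i j
    by_cases hj : j = k
    · subst hj; exact key i
    · by_cases hi : i = k
      · subst hi; rw [twoColor_comm]; exact key j
      · refine (hc.acyclic i j).anti (twoColor_mono fun e he => ?_)
        by_cases hee : e = s(u, v)
        · simp only [hee, Function.update_self, Option.some.injEq] at he
          grind
        · rwa [Function.update_of_ne hee] at he

/-! ### Exchanging two colors at a vertex -/

/-- After exchanging the colors `j` and `k` of two edges at `a` whose other ends see no further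
color of `a`, the coloring is still acyclic and the path with colors `i` and `j` from `a` to `y`
is destroyed. -/
lemma Acyc.exists_exchange (hc : Acyc c) (hu : c s(a, u) = some j) (hv : c s(a, v) = some k)
    (hjk : j ≠ k) (hau : ∀ l, Sees c a l → Sees c u l → l = j)
    (hav : ∀ l, Sees c a l → Sees c v l → l = k) (hai : ¬ Sees c a i) (hik : i ≠ k)
    (hyj : ¬ Sees c y j) (hyk : ¬ Sees c y k) (h : Linked c i j a y) :
    ∃ c', Acyc c' ∧ (∀ e, c' e = none ↔ c e = none) ∧
      (∀ w l, l ≠ j → l ≠ k → Sees c' w l → Sees c w l) ∧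
      ¬ Sees c' y j ∧
      (∀ l m s t, l ≠ j → l ≠ k → m ≠ j → m ≠ k → Linked c' l m s t → Linked c l m s t) ∧
      ¬ Linked c' i j a y ∧
      ∀ m b, m ≠ j → m ≠ k → ¬ Sees c a m → b ≠ a → ¬ Linked c m j b y → ¬ Linked c' m j b y := by
  have haj : Sees c a j := ⟨u, hu⟩
  have hak : Sees c a k := ⟨v, hv⟩
  have hya : y ≠ a := by rintro rfl; exact hyj haj
  have hyu : y ≠ u := by rintro rfl; exact hyj (.of_right hu)
  have hyv : y ≠ v := by rintro rfl; exact hyk (.of_right hv)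
  have huv : u ≠ v := by
    rintro rfl
    rw [hu] at hv
    exact hjk (Option.some.inj hv)
  have hne_au : a ≠ u := by
    rintro rfl
    rw [hc.diag] at hu
    cases hu
  have hne_av : a ≠ v := by
    rintro rfl
    rw [hc.diag] at hv
    cases hv
  have hne : s(a, u) ≠ s(a, v) := by
    intro he
    rw [he, hv] at hu
    exact hjk (Option.some.inj hu).symm
  let c₁ := Function.update (Function.update c s(a, u) none) s(a, v) none
  have hu₁ : c₁ s(a, u) = none := by simp [c₁, Function.update_of_ne hne]
  have hv₁ : c₁ s(a, v) = none := by simp [c₁]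
  have hle : ∀ e l, c₁ e = some l → c e = some l := by
    intro e l he
    simp only [c₁, Function.update_apply] at he
    split_ifs at he
    exact he
  have hsees : ∀ {w l}, Sees c₁ w l → Sees c w l := fun ⟨t, ht⟩ => ⟨t, hle _ _ ht⟩
  have hlink : ∀ {l m s t}, Linked c₁ l m s t → Linked c l m s t :=
    fun h => h.mono fun e he => he.imp (hle _ _) (hle _ _)
  have hback : ∀ {w t l}, c s(w, t) = some l → c₁ s(w, t) ≠ some l →
      s(w, t) = s(a, u) ∨ s(w, t) = s(a, v) := by
    intro w t l h1 h2
    by_contra hcon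
    rw [not_or] at hcon
    exact h2 (by simp [c₁, Function.update_of_ne hcon.1, Function.update_of_ne hcon.2, h1])
  have hc₁ : Acyc c₁ := hc.mono hle
  have haj₁ : ¬ Sees c₁ a j := by
    rintro ⟨t, ht⟩
    obtain rfl := hc.proper (hle _ _ ht) hu
    rw [hu₁] at ht
    cases ht
  have hak₁ : ¬ Sees c₁ a k := by
    rintro ⟨t, ht⟩
    obtain rfl := hc.proper (hle _ _ ht) hv
    rw [hv₁] at ht
    cases ht
  have huj₁ : ¬ Sees c₁ u j := by
    rintro ⟨t, ht⟩
    rw [Sym2.eq_swap] at hu hu₁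
    obtain rfl := hc.proper (hle _ _ ht) hu
    rw [hu₁] at ht
    cases ht
  have hvk₁ : ¬ Sees c₁ v k := by
    rintro ⟨t, ht⟩
    rw [Sym2.eq_swap] at hv hv₁
    obtain rfl := hc.proper (hle _ _ ht) hv
    rw [hv₁] at ht
    cases ht
  have huk₁ : ¬ Sees c₁ u k := fun h => hjk (hau k hak (hsees h)).symm
  have hvj₁ : ¬ Sees c₁ v j := fun h => hjk (hav j haj (hsees h))
  let c₂ := Function.update c₁ s(a, u) (some k)
  have hsees₂ : ∀ {w l}, Sees c₂ w l ↔ Sees c₁ w l ∨ (l = k ∧ (w = a ∨ w = u)) :=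
    fun {w l} => sees_update hu₁
  have hc₂ : Acyc c₂ := by
    refine hc₁.update hne_au hu₁ hak₁ huk₁ fun l hl h => ?_
    have h1 := h.symm.sees_right hak₁ hne_au.symm
    have h2 := h.sees_right huk₁ hne_au
    exact haj₁ (hau l (hsees h1) (hsees h2) ▸ h1)
  have hv₂ : c₂ s(a, v) = none := by simp [c₂, Function.update_of_ne hne.symm, hv₁]
  have haj₂ : ¬ Sees c₂ a j := by grind
  have hvj₂ : ¬ Sees c₂ v j := by grind
  let c₃ := Function.update c₂ s(a, v) (some j)
  have hsees₃ : ∀ {w l}, Sees c₃ w l ↔ Sees c₂ w l ∨ (l = j ∧ (w = a ∨ w = v)) :=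
    fun {w l} => sees_update hv₂
  have hc₃ : Acyc c₃ := by
    refine hc₂.update hne_av hv₂ haj₂ hvj₂ fun l hl h => ?_
    have h1 := h.symm.sees_right haj₂ hne_av.symm
    have h2 := h.sees_right hvj₂ hne_av
    rw [hsees₂] at h1 h2
    grind
  have hlink₃ : ∀ {l s t}, l ≠ k → Linked c₃ l j s t →
      Linked c₁ l j s t ∨ (Linked c₁ l j s a ∧ Linked c₁ l j v t) ∨
        (Linked c₁ l j s v ∧ Linked c₁ l j a t) := by
    intro l s t hl h
    exact h.of_update.imp (·.of_update_of_ne hl hjk) (Or.imp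
      (And.imp (·.of_update_of_ne hl hjk) (·.of_update_of_ne hl hjk))
      (And.imp (·.of_update_of_ne hl hjk) (·.of_update_of_ne hl hjk)))
  refine ⟨c₃, hc₃, fun e => ?_, fun w l hlj hlk h => ?_, fun h => ?_, ?_, fun h' => ?_, ?_⟩
  · simp only [c₃, c₂, c₁, Function.update_apply]
    split_ifs with h1 h2
    · subst h1; simp [hv]
    · subst h2; simp [hu]
    · rfl
  · rw [hsees₃, hsees₂] at h
    exact hsees (by tauto)
  · rw [hsees₃, hsees₂] at h
    grind
  · intro l m s t hlj hlk hmj hmk h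
    exact hlink ((h.of_update_of_ne hlj hmj).of_update_of_ne hlk hmk)
  · have hai₁ : ¬ Sees c₁ a i := fun h => hai (hsees h)
    have hcu : c = Function.update (Function.update c₁ s(a, u) (some j)) s(a, v) (some k) := by
      funext e
      simp only [c₁, Function.update_apply]
      split_ifs with h1 h2
      · rw [h1, hv]
      · rw [h2, hu]
      · rfl
    rw [hcu] at h
    have huy : Linked c₁ i j u y := by
      rcases (h.of_update_of_ne hik hjk).of_update with h | h | h
      · exact (hya (h.eq_of_not_sees hai₁ haj₁).symm).elim
      · exact h.2
      · exact (hne_au (h.1.eq_of_not_sees hai₁ haj₁)).elim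
    have hvy : Linked c₁ i j v y := by
      rcases hlink₃ hik h' with h | h | h
      · exact (hya (h.eq_of_not_sees hai₁ haj₁).symm).elim
      · exact h.2
      · exact (hne_av (h.1.eq_of_not_sees hai₁ haj₁)).elim
    exact huy.symm.false_of_three_ends hvy.symm hc₁ (.inr fun h => hyj (hsees h)) (.inr huj₁)
      (.inr hvj₁) hyu hyv huv
  · intro m b hmj hmk ham hba hl h'
    have ham₁ : ¬ Sees c₁ a m := fun h => ham (hsees h)
    rcases hlink₃ hmk h' with h | h | h
    · exact hl (hlink h)
    · exact hba (h.1.symm.eq_of_not_sees ham₁ haj₁).symm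
    · exact hya (h.2.eq_of_not_sees ham₁ haj₁).symm

/-! ### Coloring the edges at a vertex of degree at most three -/

/-- After recoloring, the vertices `a`, `b`, `y` can be joined to an isolated vertex by three
edges of distinct colors. -/
def Joinable (c : Sym2 V → Option (Fin 6)) (a b y : V) : Prop :=
  ∃ c', Acyc c' ∧ (∀ e, c' e = none ↔ c e = none) ∧ ∃ i j k, i ≠ j ∧ i ≠ k ∧ j ≠ k ∧
    ¬ Sees c' a i ∧ ¬ Sees c' b j ∧ ¬ Sees c' y k ∧
    ¬ Linked c' i j a b ∧ ¬ Linked c' i k a y ∧ ¬ Linked c' j k b y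

omit [DecidableEq V] in
lemma Joinable.swap (h : Joinable c a b y) : Joinable c b a y := by
  obtain ⟨c', hc', hn, i, j, k, hij, hik, hjk, ha, hb, hy, h1, h2, h3⟩ := h
  exact ⟨c', hc', hn, j, i, k, hij.symm, hjk, hik, hb, ha, hy, fun h => h1 h.symm.comm, h3, h2⟩

lemma joinable_of_exchange (hc : Acyc c) (hu : c s(a, u) = some j) (hv : c s(a, v) = some k)
    (hjk : j ≠ k) (hau : ∀ l, Sees c a l → Sees c u l → l = j)
    (hav : ∀ l, Sees c a l → Sees c v l → l = k) (hai : ¬ Sees c a i) (hij : i ≠ j) (hik : i ≠ k)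
    (hyj : ¬ Sees c y j) (hyk : ¬ Sees c y k) (h : Linked c i j a y) (hmi : m ≠ i) (hmj : m ≠ j)
    (hmk : m ≠ k) (hbm : ¬ Sees c b m) (hab : ¬ Linked c i m a b) (hne : b ≠ a) (hby : b ≠ y)
    (hym : ¬ Sees c y m ∨ ¬ Sees c a m ∧ ¬ Linked c m j b y) : Joinable c a b y := by
  obtain ⟨c', hc', hn, h1, h2, h3, h4, h5⟩ :=
    hc.exists_exchange hu hv hjk hau hav hai hik hyj hyk h
  refine ⟨c', hc', hn, i, m, j, hmi.symm, hij, hmj, fun h => hai (h1 _ _ hij hik h),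
    fun h => hbm (h1 _ _ hmj hmk h), h2, fun h => hab (h3 _ _ _ _ hij hik hmj hmk h), h4, ?_⟩
  rcases hym with hym | ⟨ham, hl⟩
  · intro h
    exact hby (h.symm.eq_of_not_sees (fun h => hym (h1 _ _ hmj hmk h)) h2).symm
  · exact h5 m b hmj hmk ham hne hl

omit [DecidableEq V]

lemma SeesAtMost.not_four (h : SeesAtMost c v 3) (hi : Sees c v i) (hj : Sees c v j)
    (hk : Sees c v k) (hl : Sees c v l)
    (hd : [i, j, k, l].Nodup := by
      simp only [List.nodup_cons, List.mem_cons, List.not_mem_nil, or_false, not_or,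
        not_false_eq_true, List.nodup_nil, and_true]
      and_intros <;> first | assumption | exact Ne.symm (by assumption)) : False := by
  have := h _ hd (by simp [hi, hj, hk, hl])
  simp at this

lemma SeesAtMost.not_five (h : SeesAtMost c v 4) (hi : Sees c v i) (hj : Sees c v j)
    (hk : Sees c v k) (hl : Sees c v l) (hm : Sees c v m)
    (hd : [i, j, k, l, m].Nodup := by
      simp only [List.nodup_cons, List.mem_cons, List.not_mem_nil, or_false, not_or,
        not_false_eq_true, List.nodup_nil, and_true]
      and_intros <;> first | assumption | exact Ne.symm (by assumption)) : False := by
  have := h _ hd (by simp [hi, hj, hk, hl, hm])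
  simp at this

/-- Three vertices that see at most three colors each in a coloring of maximum degree four. -/
structure Terminals (c : Sym2 V → Option (Fin 6)) (a b y : V) : Prop where
  acyc : Acyc c
  ne_ab : a ≠ b
  ne_ay : a ≠ y
  ne_by : b ≠ y
  left : SeesAtMost c a 3
  mid : SeesAtMost c b 3
  right : SeesAtMost c y 3
  four : ∀ v, SeesAtMost c v 4

lemma Terminals.swap (h : Terminals c a b y) : Terminals c b a y :=
  ⟨h.acyc, h.ne_ab.symm, h.ne_by, h.ne_ay, h.mid, h.left, h.right, h.four⟩

lemma linked_of_not_joinable (hc : Acyc c) (hN : ¬ Joinable c a b y) (hij : i ≠ j) (hik : i ≠ k)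
    (hjk : j ≠ k) (ha : ¬ Sees c a i) (hb : ¬ Sees c b j) (hy : ¬ Sees c y k) :
    Linked c i j a b ∨ Linked c i k a y ∨ Linked c j k b y := by
  by_contra hcon
  simp only [not_or] at hcon
  exact hN ⟨c, hc, fun _ => Iff.rfl, i, j, k, hij, hik, hjk, ha, hb, hy, hcon⟩

/-- The case where the color intended for `b` is missing at `y`. -/
lemma Terminals.joinable_of_not_sees [DecidableEq V] (T : Terminals c a b y) {p q : Fin 6}
    (hd : [i, j, p, q, k, l].Nodup) (hai : ¬ Sees c a i) (hbj : ¬ Sees c b j)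
    (hij : ¬ Linked c i j a b) (hyj : ¬ Sees c y j) (hyk : ¬ Sees c y k) (hyl : ¬ Sees c y l) :
    Joinable c a b y := by
  by_contra hN
  obtain ⟨hc, hab, hay, hby, ha3, hb3, hy3, h4⟩ := T
  have nw := fun {i j k : Fin 6} => linked_of_not_joinable (i := i) (j := j) (k := k) hc hN
  have hy2 : ∀ {i j}, ¬ Sees c y i → ¬ Sees c y j → ¬ Linked c i j b y :=
    fun hi hj h => hby (h.symm.eq_of_not_sees hi hj).symm
  have hb2 : ∀ {i j}, ¬ Sees c b i → ¬ Sees c b j → ¬ Linked c i j b y :=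
    fun hi hj h => hby (h.eq_of_not_sees hi hj)
  have ha2 : ∀ {i j}, ¬ Sees c a i → ¬ Sees c a j → ¬ Linked c i j a b :=
    fun hi hj h => hab (h.eq_of_not_sees hi hj)
  have three : ∀ {i j}, Linked c i j a b → Linked c i j a y → ¬ Sees c a i → ¬ Sees c b j →
      ¬ Sees c y j → False :=
    fun h h' h1 h2 h3 => h.false_of_three_ends h' hc (.inl h1) (.inr h2) (.inr h3) hab hay hby
  have hd' : i ≠ j ∧ i ≠ p ∧ i ≠ q ∧ i ≠ k ∧ i ≠ l ∧ j ≠ p ∧ j ≠ q ∧ j ≠ k ∧ j ≠ l ∧ p ≠ q ∧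
      p ≠ k ∧ p ≠ l ∧ q ≠ k ∧ q ≠ l ∧ k ≠ l := by
    simpa [not_or, and_assoc] using hd
  obtain ⟨nij, nip, niq, nik, nil, njp, njq, njk, njl, npq, npk, npl, nqk, nql, nkl⟩ := hd'
  have hk : Linked c i k a y :=
    ((nw nij nik njk hai hbj hyk).resolve_left hij).resolve_right (hy2 hyj hyk)
  have hl : Linked c i l a y :=
    ((nw nij nil njl hai hbj hyl).resolve_left hij).resolve_right (hy2 hyj hyl)
  have hak := hk.sees_left hai hay
  have hal := hl.sees_left hai hay
  have hj : Linked c i j a y := by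
    by_contra hj
    have hbk : Sees c b k := by
      by_contra hbk
      rcases nw nik nij njk.symm hai hbk hyj with h | h | h
      · exact three h hk hai hbk hyk
      · exact hj h
      · exact hy2 hyk hyj h
    have hbl : Sees c b l := by
      by_contra hbl
      rcases nw nil nij njl.symm hai hbl hyj with h | h | h
      · exact three h hl hai hbl hyl
      · exact hj h
      · exact hy2 hyl hyj h
    have hs : ∀ s, i ≠ s → s ≠ j → Sees c b s ∨ Sees c b i ∧ Sees c a s := by
      intro s his hsj
      by_contra hcon
      rw [not_or] at hcon
      rcases nw his nij hsj hai hcon.1 hyj with h | h | h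
      · exact hcon.2 ⟨h.sees_right hcon.1 hab, h.sees_left hai hab⟩
      · exact hj h
      · exact hb2 hcon.1 hbj h
    rcases hs p nip njp.symm with hp | hp <;> rcases hs q niq njq.symm with hq | hq
    · exact hb3.not_four hp hq hbk hbl
    · exact hb3.not_four hp hq.1 hbk hbl
    · exact hb3.not_four hp.1 hq hbk hbl
    · exact ha3.not_four hp.2 hq.2 hak hal
  have haj := hj.sees_left hai hay
  have hap : ¬ Sees c a p := fun h => ha3.not_four h haj hak hal
  have haq : ¬ Sees c a q := fun h => ha3.not_four h haj hak hal
  obtain ⟨u, hu⟩ := hak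
  obtain ⟨v, hv⟩ := hal
  have next : ∀ {s r w z}, c s(a, w) = some r → ¬ Sees c a s → ¬ Sees c z r → a ≠ z →
      Linked c s r a z → Sees c w s := fun hw hs hz haz h =>
    h.sees_next hc hs hw haz (by rintro rfl; exact hz (.of_right hw))
  have main : ∀ {s t r w}, s ≠ t → i ≠ s → i ≠ t → s ≠ j → t ≠ j → s ≠ k → t ≠ k → s ≠ l → t ≠ l →
      r ≠ i → r ≠ j → r ≠ s → r ≠ t → ¬ Sees c a s → ¬ Sees c a t → ¬ Sees c y r →
      c s(a, w) = some r → Sees c w s := by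
    intro s t r w hst his hit hsj htj hsk htk hsl htl hri hrj hrs hrt has hat hyr hw
    by_cases h : Linked c s j a b
    · have hsee : ∀ n, n ≠ s → n ≠ j → ¬ Sees c a n → Sees c b n := by
        intro n hns hnj han
        by_contra hbn
        rcases nw hns.symm hsj hnj has hbn hyj with h' | h' | h'
        · exact ha2 has han h'
        · exact three h h' has hbj hyj
        · exact hb2 hbn hbj h'
      have hbs := h.sees_right hbj hab
      have hbr : ¬ Sees c b r := fun h' => hb3.not_four h' hbs
        (hsee i his nij hai) (hsee t hst.symm htj hat)
      rcases nw hrs.symm hsj hrj has hbr hyj with h' | h' | h'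
      · exact next hw has hbr hab h'
      · exact (three h h' has hbj hyj).elim
      · exact (hy2 hyr hyj h').elim
    · rcases nw hsj hrs.symm hrj.symm has hbj hyr with h' | h' | h'
      · exact (h h').elim
      · exact next hw has hyr hay h'
      · exact (hy2 hyj hyr h').elim
  have only : ∀ {r w}, i ≠ r → p ≠ r → q ≠ r → c s(a, w) = some r →
      Sees c w i → Sees c w p → Sees c w q → ∀ n, Sees c a n → Sees c w n → n = r := by
    intro r w hir hpr hqr hw hwi hwp hwq n han hwn
    by_contra hnr
    have hni : n ≠ i := by rintro rfl; exact hai han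
    have hnp : n ≠ p := by rintro rfl; exact hap han
    have hnq : n ≠ q := by rintro rfl; exact haq han
    exact (h4 w).not_five hwi hwp hwq (.of_right hw) hwn
  have hup : Sees c u p := main (t := q) npq nip niq njp.symm njq.symm npk nqk npl nql nik.symm
    njk.symm npk.symm nqk.symm hap haq hyk hu
  have huq : Sees c u q := main (t := p) npq.symm niq nip njq.symm njp.symm nqk npk nql npl
    nik.symm njk.symm nqk.symm npk.symm haq hap hyk hu
  have hvp : Sees c v p := main (t := q) npq nip niq njp.symm njq.symm npk nqk npl nql nil.symm
    njl.symm npl.symm nql.symm hap haq hyl hv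
  have hvq : Sees c v q := main (t := p) npq.symm niq nip njq.symm njp.symm nqk npk nql npl
    nil.symm njl.symm nql.symm npl.symm haq hap hyl hv
  have hui : Sees c u i := next hu hai hyk hay hk
  have hvi : Sees c v i := next hv hai hyl hay hl
  exact hN (joinable_of_exchange hc hu hv nkl
    (only nik npk nqk hu hui hup huq) (only nil npl nql hv hvi hvp hvq) hai nik nil hyk hyl hk
    nij.symm njk njl hbj hij hab.symm hby (.inl hyj))

/-- The case where `a` starts paths to `y` with two common colors `k` and `l`. -/
lemma Terminals.joinable_of_linked [DecidableEq V] (T : Terminals c a b y) {p : Fin 6}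
    (hd : [i, j, p, k, l].Nodup) (hai : ¬ Sees c a i) (haj : ¬ Sees c a j) (hap : ¬ Sees c a p)
    (hbj : ¬ Sees c b j) (hij : ¬ Linked c i j a b) (hyk : ¬ Sees c y k) (hyl : ¬ Sees c y l)
    (hik : Linked c i k a y) (hjk : Linked c j k a y) (hpk : Linked c p k a y)
    (hil : Linked c i l a y) (hjl : Linked c j l a y) (hpl : Linked c p l a y)
    (hb : ¬ Linked c j k b y) : Joinable c a b y := by
  obtain ⟨hc, hab, hay, hby, -, -, -, h4⟩ := T
  have hd' : i ≠ j ∧ i ≠ p ∧ i ≠ k ∧ i ≠ l ∧ j ≠ p ∧ j ≠ k ∧ j ≠ l ∧ p ≠ k ∧ p ≠ l ∧ k ≠ l := by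
    simpa [not_or, and_assoc] using hd
  obtain ⟨nij, nip, nik, nil, njp, njk, njl, npk, npl, nkl⟩ := hd'
  obtain ⟨u, hu⟩ := hik.sees_left hai hay
  obtain ⟨v, hv⟩ := hil.sees_left hai hay
  have next : ∀ {s r w}, c s(a, w) = some r → ¬ Sees c a s → ¬ Sees c y r →
      Linked c s r a y → Sees c w s := fun hw hs hy h =>
    h.sees_next hc hs hw hay (by rintro rfl; exact hy (.of_right hw))
  have only : ∀ {r w}, i ≠ r → j ≠ r → p ≠ r → c s(a, w) = some r →
      Sees c w i → Sees c w j → Sees c w p → ∀ n, Sees c a n → Sees c w n → n = r := by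
    intro r w hir hjr hpr hw hwi hwj hwp n han hwn
    by_contra hnr
    have hni : n ≠ i := by rintro rfl; exact hai han
    have hnj : n ≠ j := by rintro rfl; exact haj han
    have hnp : n ≠ p := by rintro rfl; exact hap han
    exact (h4 w).not_five hwi hwj hwp (.of_right hw) hwn
  exact joinable_of_exchange hc hu hv nkl
    (only nik njk npk hu (next hu hai hyk hik) (next hu haj hyk hjk) (next hu hap hyk hpk))
    (only nil njl npl hv (next hv hai hyl hil) (next hv haj hyl hjl) (next hv hap hyl hpl))
    hai nik nil hyk hyl hik nij.symm njk njl hbj hij hab.symm hby (.inr ⟨haj, hb⟩)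

lemma Terminals.sees_of_not_joinable [DecidableEq V] (T : Terminals c a b y)
    (hN : ¬ Joinable c a b y) {p n : Fin 6} (hd : [i, j, p, k, l, n].Nodup) (hai : ¬ Sees c a i)
    (hbj : ¬ Sees c b j) (hij : ¬ Linked c i j a b) (hyk : ¬ Sees c y k) (hyl : ¬ Sees c y l)
    (hyn : ¬ Sees c y n) : Sees c a k := by
  by_contra hak
  have h : Linked c j k b a := by
    by_contra h
    exact hN (T.swap.joinable_of_not_sees (i := j) (j := k) (p := i) (q := p) (k := l) (l := n)
      (by clear * - hd; grind) hbj hak h hyk hyl hyn).swap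
  rcases linked_of_not_joinable (i := i) (j := j) (k := k) T.acyc hN (by clear * - hd; grind)
    (by clear * - hd; grind) (by clear * - hd; grind) hai hbj hyk with h' | h' | h'
  · exact hij h'
  · exact T.ne_ay (h'.eq_of_not_sees hai hak)
  · exact h.false_of_three_ends h' T.acyc (.inl hbj) (.inr hak) (.inr hyk) T.ne_ab.symm T.ne_by
      T.ne_ay

/-- The case where neither of the colors intended for `a` and `b` is known to be missing
at `y`. -/
lemma Terminals.joinable_of_not_sees_of_ne [DecidableEq V] (T : Terminals c a b y)
    {p n : Fin 6} (hd : [i, j, p, k, l, n].Nodup) (hai : ¬ Sees c a i) (hbj : ¬ Sees c b j)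
    (hij : ¬ Linked c i j a b) (hyk : ¬ Sees c y k) (hyl : ¬ Sees c y l) (hyn : ¬ Sees c y n) :
    Joinable c a b y := by
  by_contra hN
  have hji : ¬ Linked c j i b a := fun h => hij h.symm.comm
  have hN' : ¬ Joinable c b a y := fun h => hN h.swap
  have hak := T.sees_of_not_joinable hN hd hai hbj hij hyk hyl hyn
  have hal := T.sees_of_not_joinable hN (k := l) (l := k) (n := n) (p := p)
    (by clear * - hd; grind) hai hbj hij hyl hyk hyn
  have han := T.sees_of_not_joinable hN (k := n) (l := k) (n := l) (p := p)
    (by clear * - hd; grind) hai hbj hij hyn hyk hyl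
  have hbk := T.swap.sees_of_not_joinable hN' (k := k) (l := l) (n := n) (p := p)
    (by clear * - hd; grind) hbj hai hji hyk hyl hyn
  have hbl := T.swap.sees_of_not_joinable hN' (k := l) (l := k) (n := n) (p := p)
    (by clear * - hd; grind) hbj hai hji hyl hyk hyn
  have hbn := T.swap.sees_of_not_joinable hN' (k := n) (l := k) (n := l) (p := p)
    (by clear * - hd; grind) hbj hai hji hyn hyk hyl
  have hd' : i ≠ j ∧ i ≠ p ∧ i ≠ k ∧ i ≠ l ∧ i ≠ n ∧ j ≠ p ∧ j ≠ k ∧ j ≠ l ∧ j ≠ n ∧ p ≠ k ∧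
      p ≠ l ∧ p ≠ n ∧ k ≠ l ∧ k ≠ n ∧ l ≠ n := by
    simpa [not_or, and_assoc] using hd
  obtain ⟨nij, nip, nik, nil, nin, njp, njk, njl, njn, npk, npl, npn, nkl, nkn, nln⟩ := hd'
  have haj : ¬ Sees c a j := fun h => T.left.not_four h hak hal han
  have hap : ¬ Sees c a p := fun h => T.left.not_four h hak hal han
  have hbi : ¬ Sees c b i := fun h => T.mid.not_four h hbk hbl hbn
  have hbp : ¬ Sees c b p := fun h => T.mid.not_four h hbk hbl hbn
  have one : ∀ {s t r}, s ≠ t → s ≠ r → t ≠ r → ¬ Sees c a s → ¬ Sees c a t → ¬ Sees c b t →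
      ¬ Sees c y r → Linked c s r a y ∨ Linked c t r b y := fun hst hsr htr has hat hbt hyr =>
    (linked_of_not_joinable T.acyc hN hst hsr htr has hbt hyr).resolve_left fun h =>
      T.ne_ab (h.eq_of_not_sees has hat)
  have both : ∀ {s r}, ¬ Sees c a s → ¬ Sees c b s → ¬ Sees c y r → Linked c s r a y →
      ¬ Linked c s r b y := fun has hbs hyr h h' =>
    h.symm.false_of_three_ends h'.symm T.acyc (.inr hyr) (.inl has) (.inl hbs) T.ne_ay.symm
      T.ne_by.symm T.ne_ab
  have split : ∀ {r}, i ≠ r → j ≠ r → p ≠ r → ¬ Sees c y r →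
      (Linked c i r a y ∧ Linked c j r a y ∧ Linked c p r a y ∧ ¬ Linked c j r b y) ∨
      (Linked c i r b y ∧ Linked c j r b y ∧ Linked c p r b y ∧ ¬ Linked c j r a y) := by
    intro r hi hj hp hr
    have h1 := one nij hi hj hai haj hbj hr
    have h2 := one nij.symm hj hi haj hai hbi hr
    have h3 := one nip hi hp hai hap hbp hr
    have h4 := one nip.symm hp hi hap hai hbi hr
    have h5 := one njp hj hp haj hap hbp hr
    have h6 := one njp.symm hp hj hap haj hbj hr
    have h7 := both hai hbi hr
    have h8 := both haj hbj hr
    have h9 := both hap hbp hr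
    clear * - h1 h2 h3 h4 h5 h6 h7 h8 h9
    tauto
  have ha : ∀ {r s}, [i, j, p, r, s].Nodup → ¬ Sees c y r → ¬ Sees c y s →
      (Linked c i r a y ∧ Linked c j r a y ∧ Linked c p r a y ∧ ¬ Linked c j r b y) →
      ¬ (Linked c i s a y ∧ Linked c j s a y ∧ Linked c p s a y ∧ ¬ Linked c j s b y) :=
    fun h hr hs ⟨h1, h2, h3, h4⟩ ⟨h5, h6, h7, _⟩ => hN (T.joinable_of_linked h hai haj hap hbj hij
      hr hs h1 h2 h3 h5 h6 h7 h4)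
  have hb : ∀ {r s}, [i, j, p, r, s].Nodup → ¬ Sees c y r → ¬ Sees c y s →
      (Linked c i r b y ∧ Linked c j r b y ∧ Linked c p r b y ∧ ¬ Linked c j r a y) →
      ¬ (Linked c i s b y ∧ Linked c j s b y ∧ Linked c p s b y ∧ ¬ Linked c j s a y) :=
    fun h hr hs ⟨h1, h2, h3, h4⟩ ⟨h5, h6, h7, _⟩ => hN' (T.swap.joinable_of_linked h hbi hbj hbp
      haj (fun h => hji h.comm) hr hs h1 h2 h3 h5 h6 h7 h4)
  have d1 : [i, j, p, k, l].Nodup := by clear * - hd; grind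
  have d2 : [i, j, p, k, n].Nodup := by clear * - hd; grind
  have d3 : [i, j, p, l, n].Nodup := by clear * - hd; grind
  rcases split nik njk npk hyk with h1 | h1 <;> rcases split nil njl npl hyl with h2 | h2 <;>
    rcases split nin njn npn hyn with h3 | h3
  · exact ha d1 hyk hyl h1 h2
  · exact ha d1 hyk hyl h1 h2
  · exact ha d2 hyk hyn h1 h3
  · exact hb d3 hyl hyn h2 h3
  · exact ha d3 hyl hyn h2 h3
  · exact hb d2 hyk hyn h1 h3
  · exact hb d1 hyk hyl h1 h2
  · exact hb d1 hyk hyl h1 h2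

lemma SeesAtMost.exists_not_sees (h : SeesAtMost c v 3) :
    ∃ k l n, k ≠ l ∧ k ≠ n ∧ l ≠ n ∧ ¬ Sees c v k ∧ ¬ Sees c v l ∧ ¬ Sees c v n := by
  classical
  have h1 : (Finset.univ.filter fun k => Sees c v k).card ≤ 3 := by
    rw [← Finset.length_toList]
    exact h _ (Finset.nodup_toList _) (by simp)
  have h2 := Finset.card_filter_add_card_filter_not (s := (Finset.univ : Finset (Fin 6)))
    (fun k => Sees c v k)
  rw [Finset.card_univ, Fintype.card_fin] at h2
  obtain ⟨k, l, n, hk, hl, hn, hkl, hkn, hln⟩ := Finset.two_lt_card_iff.1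
    (show 2 < (Finset.univ.filter fun k => ¬ Sees c v k).card by omega)
  simp only [Finset.mem_filter_univ] at hk hl hn
  exact ⟨k, l, n, hkl, hkn, hln, hk, hl, hn⟩

lemma exists_color_notMem (l : List (Fin 6)) (hl : l.length < 6) : ∃ k, k ∉ l := by
  obtain ⟨k, -, hk⟩ := Finset.exists_mem_notMem_of_card_lt_card (s := l.toFinset)
    (t := Finset.univ) (lt_of_le_of_lt (List.toFinset_card_le l) (by simpa using hl))
  exact ⟨k, fun h => hk (List.mem_toFinset.2 h)⟩

lemma Terminals.joinable_of_not_sees_of_sees [DecidableEq V] (T : Terminals c a b y)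
    (hij : i ≠ j) (hai : ¬ Sees c a i) (hbj : ¬ Sees c b j) (h : ¬ Linked c i j a b)
    (hyi : Sees c y i) (hyj : ¬ Sees c y j) : Joinable c a b y := by
  obtain ⟨k, l, hkl, hjk, hjl, hyk, hyl⟩ :
      ∃ k l, k ≠ l ∧ j ≠ k ∧ j ≠ l ∧ ¬ Sees c y k ∧ ¬ Sees c y l := by
    obtain ⟨k, l, n, hkl, hkn, hln, hk, hl, hn⟩ := T.right.exists_not_sees
    by_cases hjk : j = k
    · exact ⟨l, n, hln, hjk ▸ hkl, hjk ▸ hkn, hl, hn⟩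
    · by_cases hjl : j = l
      · exact ⟨k, n, hkn, hjk, hjl ▸ hln, hk, hn⟩
      · exact ⟨k, l, hkl, hjk, hjl, hk, hl⟩
  have hik : i ≠ k := by rintro rfl; exact hyk hyi
  have hil : i ≠ l := by rintro rfl; exact hyl hyi
  obtain ⟨p, hp⟩ := exists_color_notMem [i, j, k, l] (by simp)
  obtain ⟨q, hq⟩ := exists_color_notMem [i, j, p, k, l] (by simp)
  exact T.joinable_of_not_sees (p := p) (q := q)
    (by clear * - hij hkl hjk hjl hik hil hp hq; grind) hai hbj h hyj hyk hyl

lemma Terminals.joinable [DecidableEq V] (T : Terminals c a b y) (hij : i ≠ j)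
    (hai : ¬ Sees c a i) (hbj : ¬ Sees c b j) (h : ¬ Linked c i j a b) : Joinable c a b y := by
  by_cases hyi : Sees c y i <;> by_cases hyj : Sees c y j
  · obtain ⟨k, l, n, hkl, hkn, hln, hk, hl, hn⟩ := T.right.exists_not_sees
    obtain ⟨p, hp⟩ := exists_color_notMem [i, j, k, l, n] (by simp)
    refine T.joinable_of_not_sees_of_ne (p := p) (k := k) (l := l) (n := n) ?_ hai hbj h hk hl hn
    have : ∀ {s t}, Sees c y s → ¬ Sees c y t → s ≠ t := fun hs ht hst => ht (hst ▸ hs)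
    have h1 := this hyi hk
    have h2 := this hyi hl
    have h3 := this hyi hn
    have h4 := this hyj hk
    have h5 := this hyj hl
    have h6 := this hyj hn
    clear * - hij hkl hkn hln hp h1 h2 h3 h4 h5 h6
    grind
  · exact T.joinable_of_not_sees_of_sees hij hai hbj h hyi hyj
  · exact (T.swap.joinable_of_not_sees_of_sees hij.symm hbj hai (fun h' => h h'.symm.comm) hyj
      hyi).swap
  · obtain ⟨k, hik, hjk, hyk⟩ : ∃ k, i ≠ k ∧ j ≠ k ∧ ¬ Sees c y k := by
      obtain ⟨k, l, n, hkl, hkn, hln, hk, hl, hn⟩ := T.right.exists_not_sees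
      by_contra! hcon
      have h1 := fun h h' => hk (hcon k h h')
      have h2 := fun h h' => hl (hcon l h h')
      have h3 := fun h h' => hn (hcon n h h')
      clear * - hkl hkn hln h1 h2 h3
      grind
    exact ⟨c, T.acyc, fun _ => Iff.rfl, i, j, k, hij, hik, hjk, hai, hbj, hyk, h,
      fun h => T.ne_ay (h.symm.eq_of_not_sees hyi hyk).symm,
      fun h => T.ne_by (h.symm.eq_of_not_sees hyj hyk).symm⟩

/-- Coloring the edges from an isolated vertex `x` to `a`, `b`, `y`; here `b = x` is allowed and
means that only `a` and `y` are joined to `x`. -/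
lemma Joinable.exists_extension [DecidableEq V] (h : Joinable c a b y) (hx : ∀ k, ¬ Sees c x k)
    (hxa : x ≠ a) (hxy : x ≠ y) (hab : a ≠ b) (hay : a ≠ y) (hby : b ≠ y) :
    ∃ c', Acyc c' ∧ ∀ e, c' e = none ↔
      c e = none ∧ e ≠ s(x, y) ∧ e ≠ s(x, a) ∧ (b = x ∨ e ≠ s(x, b)) := by
  obtain ⟨d, hd, hn, i, j, k, hij, hik, hjk, ha, hb, hy, hlab, hlay, hlby⟩ := h
  have hxn : ∀ w, d s(x, w) = none := by
    intro w
    rw [hn]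
    by_contra hw
    obtain ⟨k, hk⟩ := Option.ne_none_iff_exists'.1 hw
    exact hx k ⟨w, hk⟩
  have hxd : ∀ k, ¬ Sees d x k := by
    rintro k ⟨w, hw⟩
    rw [hxn] at hw
    cases hw
  have hxl : ∀ {l m w}, Linked d l m x w → x = w := fun h => h.eq_of_not_sees (hxd _) (hxd _)
  let d₁ := Function.update d s(x, y) (some k)
  have hs₁ : ∀ {w l}, Sees d₁ w l ↔ Sees d w l ∨ (l = k ∧ (w = x ∨ w = y)) :=
    fun {w l} => sees_update (hxn y)
  have hd₁ : Acyc d₁ := hd.update hxy (hxn y) (hxd k) hy fun l _ h => hxy (hxl h)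
  have hn₁ : ∀ {w}, w ≠ y → d₁ s(x, w) = none := by
    intro w hw
    rw [← hxn w]
    exact Function.update_of_ne (by simpa [hxy] using hw) _ _
  have hl₁ : ∀ {l w}, l ≠ k → w ≠ x → Linked d₁ k l x w → Linked d k l y w := by
    intro l w hl hw h
    rcases h.of_update with h | h | h
    · exact (hw (hxl h).symm).elim
    · exact h.2
    · exact (hxy (hxl h.1)).elim
  let d₂ := Function.update d₁ s(x, a) (some i)
  have hs₂ : ∀ {w l}, Sees d₂ w l ↔ Sees d₁ w l ∨ (l = i ∧ (w = x ∨ w = a)) :=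
    fun {w l} => sees_update (hn₁ hay)
  have hd₂ : Acyc d₂ := by
    refine hd₁.update hxa (hn₁ hay) ?_ ?_ fun l _ h => ?_
    · simp [hs₁, hxd, hik]
    · simp [hs₁, ha, hik]
    · by_cases hlk : l = k
      · subst hlk
        exact hlay (hl₁ hik hxa.symm h).symm.comm
      · exact hxa (hxl (h.of_update_of_ne hlk hik))
  have hn₂ : ∀ {w}, w ≠ y → w ≠ a → d₂ s(x, w) = none := by
    intro w hwy hwa
    rw [← hn₁ hwy]
    exact Function.update_of_ne (by simpa [hxa] using hwa) _ _
  have hnone : ∀ e, d₂ e = none ↔ c e = none ∧ e ≠ s(x, y) ∧ e ≠ s(x, a) := by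
    intro e
    simp only [d₂, d₁, Function.update_apply]
    split_ifs with h1 h2 <;> simp [*]
  by_cases hbx : b = x
  · exact ⟨d₂, hd₂, fun e => by simp [hnone, hbx]⟩
  refine ⟨Function.update d₂ s(x, b) (some j), ?_, fun e => ?_⟩
  · refine hd₂.update (Ne.symm hbx) (hn₂ hby hab.symm) ?_ ?_ fun l _ h => ?_
    · simp [hs₂, hs₁, hxd, hjk, hij.symm]
    · simp [hs₂, hs₁, hb, hjk, hij.symm]
    · by_cases hli : l = i
      · subst hli
        rcases h.of_update with h | h | h
        · exact hbx (hxl (h.of_update_of_ne hik hjk)).symm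
        · exact hlab (h.2.of_update_of_ne hik hjk)
        · exact hxa (hxl (h.1.of_update_of_ne hik hjk))
      · have h' := h.of_update_of_ne hli hij.symm
        by_cases hlk : l = k
        · subst hlk
          exact hlby (hl₁ hjk hbx h').symm.comm
        · exact hbx (hxl (h'.of_update_of_ne hlk hjk)).symm
  · by_cases he : e = s(x, b)
    · simp [he, hbx]
    · simp [hnone, he]

lemma seesAtMost_of_ncard_le [Finite V] {n : ℕ} (S : Set V) (hS : ∀ w, c s(v, w) ≠ none → w ∈ S)
    (hn : S.ncard ≤ n) : SeesAtMost c v n := by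
  intro l hl h
  have : Nonempty V := ⟨v⟩
  choose! f hf using h
  rw [← List.toFinset_card_of_nodup hl, ← Set.ncard_coe_finset]
  refine (Set.ncard_le_ncard_of_injOn f (fun k hk => hS _ ?_) ?_).trans hn
  · simp [hf k (by simpa using hk)]
  · intro k hk k' hk' hkk
    have h1 := hf k (by simpa using hk)
    rw [hkk, hf k' (by simpa using hk')] at h1
    exact (Option.some.inj h1).symm

/-- Uncoloring the edges at `x` separates the neighbors of `x`. -/
lemma Acyc.not_linked (hc : Acyc c) (h : ∀ e k, c' e = some k → c e = some k ∧ x ∉ e)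
    (ha : c s(x, a) = some i) (hb : c s(x, b) = some j) (hab : a ≠ b) : ¬ Linked c' i j a b := by
  intro hl
  have hne : ∀ {w k}, c s(x, w) = some k → x ≠ w := by
    rintro w k hw rfl
    rw [hc.diag] at hw
    cases hw
  have hadj : (twoColor c i j).Adj x a := ⟨hne ha, .inl ha⟩
  refine isBridge_iff.1 (isAcyclic_iff_forall_adj_isBridge.1 (hc.acyclic i j) hadj) ?_
  have h1 : ((twoColor c i j).deleteEdges {s(x, a)}).Adj x b := by
    rw [deleteEdges_adj]
    exact ⟨⟨hne hb, .inr hb⟩, by simp [hab.symm, hne ha]⟩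
  refine h1.reachable.trans (Reachable.mono ?_ hl.symm)
  rintro s t ⟨hst, he⟩
  have hx : x ∉ s(s, t) := he.elim (fun he => (h _ _ he).2) fun he => (h _ _ he).2
  rw [deleteEdges_adj]
  refine ⟨⟨hst, he.imp (fun he => (h _ _ he).1) fun he => (h _ _ he).1⟩, fun hmem => hx ?_⟩
  rw [Set.mem_singleton_iff.1 hmem]
  exact Sym2.mem_mk_left x a

/-- A coloring of `H - xy` extends to `H` when `x` has degree at most three. -/
lemma Acyc.exists_of_deleteEdges [Finite V] {H : SimpleGraph V} (hc : Acyc c)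
    (hcH : ∀ e, c e = none ↔ e ∉ (H.deleteEdges {s(x, y)}).edgeSet)
    (hH : ∀ v, (H.neighborSet v).ncard ≤ 4) (hx : (H.neighborSet x).ncard ≤ 3)
    (hxy : H.Adj x y) : ∃ c', Acyc c' ∧ ∀ e, c' e = none ↔ e ∉ H.edgeSet := by
  classical
  let d : Sym2 V → Option (Fin 6) := fun e => if x ∈ e then none else c e
  have hdc : ∀ e k, d e = some k → c e = some k ∧ x ∉ e := by
    intro e k he
    simp only [d] at he
    split_ifs at he with hxe
    exact ⟨he, hxe⟩
  have hd : Acyc d := hc.mono fun e k he => (hdc e k he).1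
  have hdn : ∀ e, d e = none ↔ x ∈ e ∨ e ∉ H.edgeSet := by
    intro e
    by_cases hxe : x ∈ e
    · simp [d, hxe]
    · have : e ≠ s(x, y) := by
        rintro rfl
        exact hxe (Sym2.mem_mk_left x y)
      simp [d, hxe, hcH, edgeSet_deleteEdges, this]
  have hdx : ∀ k, ¬ Sees d x k := by
    rintro k ⟨w, hw⟩
    exact (hdc _ _ hw).2 (Sym2.mem_mk_left x w)
  have hadj : ∀ {v w}, d s(v, w) ≠ none → H.Adj v w ∧ w ≠ x := by
    intro v w h
    rw [Ne, hdn, not_or, not_not, mem_edgeSet] at h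
    refine ⟨h.2, ?_⟩
    rintro rfl
    exact h.1 (Sym2.mem_mk_right v w)
  have h4 : ∀ v, SeesAtMost d v 4 := fun v =>
    seesAtMost_of_ncard_le (H.neighborSet v) (fun w hw => (hadj hw).1) (hH v)
  have h3 : ∀ {v}, H.Adj x v → SeesAtMost d v 3 := by
    intro v hv
    refine seesAtMost_of_ncard_le (H.neighborSet v \ {x}) (fun w hw => hadj hw) ?_
    rw [Set.ncard_sdiff_singleton_of_mem (show x ∈ H.neighborSet v from hv.symm)]
    have := hH v
    omega
  have hcol : ∀ {w}, H.Adj x w → w ≠ y → ∃ k, c s(x, w) = some k ∧ ¬ Sees d w k := by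
    intro w hw hwy
    have : c s(x, w) ≠ none := by
      rw [Ne, hcH, not_not, mem_edgeSet, deleteEdges_adj]
      exact ⟨hw, by simpa [hxy.ne] using hwy⟩
    obtain ⟨k, hk⟩ := Option.ne_none_iff_exists'.1 this
    refine ⟨k, hk, fun ⟨t, ht⟩ => ?_⟩
    obtain ⟨h1, h2⟩ := hdc _ _ ht
    rw [Sym2.eq_swap] at hk
    obtain rfl := hc.proper h1 hk
    exact h2 (Sym2.mem_mk_right w t)
  have hcard : (H.neighborSet x \ {y}).ncard ≤ 2 := by
    rw [Set.ncard_sdiff_singleton_of_mem (show y ∈ H.neighborSet x from hxy)]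
    omega
  have hmem : ∀ w, w ∈ H.neighborSet x \ {y} ↔ H.Adj x w ∧ w ≠ y := fun w => Iff.rfl
  have hfin : ∀ {a b}, H.Adj x a → (b = x ∨ H.Adj x b) →
      (∀ w, H.Adj x w → w = y ∨ w = a ∨ w = b) → ∀ e,
      (d e = none ∧ e ≠ s(x, y) ∧ e ≠ s(x, a) ∧ (b = x ∨ e ≠ s(x, b))) ↔ e ∉ H.edgeSet := by
    intro a b ha hb hw e
    rw [hdn]
    constructor
    · rintro ⟨he, h1, h2, h3⟩ hmem
      obtain ⟨w, rfl⟩ := he.resolve_right (not_not.2 hmem)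
      rcases hw w hmem with rfl | rfl | rfl
      · exact h1 rfl
      · exact h2 rfl
      · exact h3.elim (fun h => H.ne_of_adj hmem h.symm) fun h => h rfl
    · intro he
      refine ⟨.inr he, ?_, ?_, ?_⟩
      · rintro rfl
        exact he hxy
      · rintro rfl
        exact he ha
      · refine hb.imp_right fun hb => ?_
        rintro rfl
        exact he hb
  rcases Nat.lt_or_ge (H.neighborSet x \ {y}).ncard 1 with h0 | h1
  · obtain ⟨k, -, -, -, -, -, hk, -⟩ := (h3 hxy).exists_not_sees
    have hS := (Set.ncard_eq_zero (Set.toFinite _)).1 (Nat.lt_one_iff.1 h0)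
    refine ⟨Function.update d s(x, y) (some k), hd.update hxy.ne
      ((hdn _).2 (.inl (Sym2.mem_mk_left x y))) (hdx k) hk
      fun l _ h => hxy.ne (h.eq_of_not_sees (hdx _) (hdx _)), fun e => ?_⟩
    rw [← hfin hxy (.inl rfl) fun w hw => .inl ?_]
    · by_cases he : e = s(x, y)
      · simp [he]
      · simp [he]
    · by_contra hwy
      exact hS.subset ((hmem w).2 ⟨hw, hwy⟩)
  rcases Nat.lt_or_ge (H.neighborSet x \ {y}).ncard 2 with h1' | h2
  · obtain ⟨a, hS⟩ := Set.ncard_eq_one.1 (by omega : (H.neighborSet x \ {y}).ncard = 1)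
    obtain ⟨ha, hay⟩ := (hmem a).1 (by simp [hS])
    obtain ⟨i, -, hi⟩ := hcol ha hay
    obtain ⟨j, hj⟩ := exists_color_notMem [i] (by simp)
    have T : Terminals d a x y := ⟨hd, ha.ne', hay, hxy.ne, h3 ha,
      seesAtMost_of_ncard_le ∅ (fun w hw => hw ((hdn _).2 (.inl (Sym2.mem_mk_left x w))))
        (by simp), h3 hxy, h4⟩
    obtain ⟨c', hc', hn⟩ := (T.joinable (i := i) (j := j) (by simpa [eq_comm] using hj) hi (hdx j)
      fun h => ha.ne (h.symm.eq_of_not_sees (hdx _) (hdx _))).exists_extension hdx ha.ne hxy.ne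
        ha.ne' hay hxy.ne
    refine ⟨c', hc', fun e => (hn e).trans (hfin ha (.inl rfl) (fun w hw => ?_) e)⟩
    by_cases hwy : w = y
    · exact .inl hwy
    · exact .inr (.inl (hS.subset ((hmem w).2 ⟨hw, hwy⟩)))
  · obtain ⟨a, b, hab, hS⟩ := Set.ncard_eq_two.1 (le_antisymm hcard h2)
    obtain ⟨ha, hay⟩ := (hmem a).1 (by simp [hS])
    obtain ⟨hb, hby⟩ := (hmem b).1 (by simp [hS])
    obtain ⟨i, hai, hi⟩ := hcol ha hay
    obtain ⟨j, hbj, hj⟩ := hcol hb hby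
    have hij : i ≠ j := by
      rintro rfl
      exact hab (hc.proper hai hbj)
    have T : Terminals d a b y := ⟨hd, hab, hay, hby, h3 ha, h3 hb, h3 hxy, h4⟩
    obtain ⟨c', hc', hn⟩ := (T.joinable hij hi hj
      (hc.not_linked hdc hai hbj hab)).exists_extension hdx ha.ne hxy.ne hab hay hby
    refine ⟨c', hc', fun e => (hn e).trans (hfin ha (.inr hb) (fun w hw => ?_) e)⟩
    by_cases hwy : w = y
    · exact .inl hwy
    · exact .inr (hS.subset ((hmem w).2 ⟨hw, hwy⟩))

/-- If every subgraph with an edge has a vertex of degree between one and three, then six colors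
suffice. -/
lemma exists_acyc [Finite V] {G : SimpleGraph V} (hG : ∀ v, (G.neighborSet v).ncard ≤ 4)
    (hdeg : ∀ H ≤ G, H ≠ ⊥ → ∃ x y, H.Adj x y ∧ (H.neighborSet x).ncard ≤ 3) :
    ∀ H ≤ G, ∃ c, Acyc c ∧ ∀ e, c e = none ↔ e ∉ H.edgeSet := by
  intro H
  induction H using WellFoundedLT.induction with
  | ind H ih =>
    intro hHG
    by_cases hbot : H = ⊥
    · refine ⟨fun _ => none, ⟨fun _ => rfl, fun h => by simp at h, fun i j => ?_⟩, ?_⟩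
      · convert isAcyclic_bot
        ext u v
        simp [twoColor]
      · simp [hbot]
    · obtain ⟨x, y, hxy, hx⟩ := hdeg H hHG hbot
      have hle : H.deleteEdges {s(x, y)} ≤ H := deleteEdges_le _
      obtain ⟨c, hc, hcH⟩ := ih _ (lt_of_le_of_ne hle fun h => by
        rw [← h, deleteEdges_adj] at hxy
        exact hxy.2 rfl) (hle.trans hHG)
      exact hc.exists_of_deleteEdges hcH
        (fun v => (Set.ncard_le_ncard fun w hw => hHG hw).trans (hG v)) hx hxy

lemma Acyc.acyclicEdgeColorable {G : SimpleGraph V} (hc : Acyc c)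
    (hcG : ∀ e, c e = none ↔ e ∉ G.edgeSet) : AcyclicEdgeColorable G 6 := by
  have hsome : ∀ {e}, e ∈ G.edgeSet → c e = some ((c e).getD 0) := by
    intro e he
    obtain ⟨k, hk⟩ := Option.ne_none_iff_exists'.1 (mt (hcG e).1 (not_not.2 he))
    simp [hk]
  refine ⟨fun e => (c e).getD 0, ?_, ?_⟩
  · rintro e₁ h₁ e₂ h₂ hne ⟨v, ⟨u, rfl⟩, ⟨w, rfl⟩⟩ heq
    have h1 := hsome h₁
    have h2 := hsome h₂
    simp only at heq
    rw [heq] at h1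
    exact hne (by rw [hc.proper h1 h2])
  · rintro v p hp ⟨i, j, hij⟩
    have hmem : ∀ e ∈ p.edges, e ∈ (twoColor c i j).edgeSet := by
      intro e he
      have heG := p.edges_subset_edgeSet he
      have h1 := hsome heG
      induction e with
      | h s t =>
        exact ⟨G.ne_of_adj heG, (hij _ he).imp (fun h => h1.trans (congrArg some h))
          fun h => h1.trans (congrArg some h)⟩
    exact hc.acyclic i j _ (hp.transfer hmem)

end PartialEdgeColoring

/-- A connected graph of maximum degree at most four that is not four-regular is hereditarily
of minimum positive degree at most three. -/
lemma SimpleGraph.Connected.exists_adj_ncard_neighborSet_le {V : Type*} [Finite V]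
    {G : SimpleGraph V} (hconn : G.Connected) {n : ℕ} (hG : ∀ v, (G.neighborSet v).ncard ≤ n + 1)
    (hlt : ∃ v, (G.neighborSet v).ncard ≤ n) {H : SimpleGraph V} (hHG : H ≤ G) (hH : H ≠ ⊥) :
    ∃ x y, H.Adj x y ∧ (H.neighborSet x).ncard ≤ n := by
  by_contra! hcon
  have heq : ∀ {x y}, H.Adj x y → H.neighborSet x = G.neighborSet x := fun {x y} hxy =>
    Set.eq_of_subset_of_ncard_le (fun w hw => hHG hw) ((hG x).trans (hcon x y hxy))
  obtain ⟨x, y, hxy⟩ := ne_bot_iff_exists_adj.1 hH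
  have hall : ∀ v, ∃ w, H.Adj v w := by
    intro v
    obtain ⟨p⟩ := hconn.preconnected v x
    induction p with
    | nil => exact ⟨y, hxy⟩
    | @cons s t _ h p ih =>
      obtain ⟨w, hw⟩ := ih hxy
      have hs : s ∈ H.neighborSet t := by
        rw [heq hw]
        exact h.symm
      exact ⟨t, Adj.symm hs⟩
  obtain ⟨v, hv⟩ := hlt
  obtain ⟨w, hw⟩ := hall v
  have := hcon v w hw
  rw [heq hw] at this
  omega

theorem stmt18 {V : Type*} [Fintype V] [DecidableEq V] (G : SimpleGraph V) [DecidableRel G.Adj]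
    (hconn : G.Connected)
    (hm : G.edgeFinset.card ≤ 2 * Fintype.card V - 1)
    (hΔ : G.maxDegree ≤ 4) :
    acyclicChromaticIndex G ≤ 6 := by
  have hcard : ∀ v, (G.neighborSet v).ncard = G.degree v := fun v => by
    rw [← card_neighborSet_eq_degree, Set.ncard_eq_toFinset_card', Set.toFinset_card]
  have hG : ∀ v, (G.neighborSet v).ncard ≤ 4 := fun v =>
    (hcard v).trans_le ((G.degree_le_maxDegree v).trans hΔ)
  have hlt : ∃ v, (G.neighborSet v).ncard ≤ 3 := by
    by_contra! hcon
    have h1 : Fintype.card V * 4 ≤ ∑ v, G.degree v := by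
      rw [← Finset.card_univ, ← smul_eq_mul]
      exact Finset.card_nsmul_le_sum _ _ _ fun v _ => hcard v ▸ hcon v
    have h2 := G.sum_degrees_eq_twice_card_edges
    have := hconn.nonempty
    have h3 : 0 < Fintype.card V := Fintype.card_pos
    omega
  obtain ⟨c, hc, hcG⟩ := PartialEdgeColoring.exists_acyc hG
    (fun H hH hne => hconn.exists_adj_ncard_neighborSet_le hG hlt hH hne) G le_rfl
  exact Nat.sInf_le (hc.acyclicEdgeColorable hcG)
end
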